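/- arXiv:2409.03310 — 7 statements merged into one kernel-verified Lean document; each statement's English description precedes it below -/
import Mathlib

section
/- Let (X,f) be a dynamical system which is totally transitive and uniquely ergodic but not totally uniquely ergodic. Then there exists a prime p such that Q_{f^p}^e(X) ≠ X. -/
open MeasureTheory Filter Topology Set
open scoped ENNReal NNReal

attribute [local instance] Matrix.normedAddCommGroup

noncomputable section

/-- The cocycle `A(n,x) = A(f^{n-1}x) ⋯ A(fx) A(x)` generated by a matrix-valued map `A`. -/
def cocycle {X : Type*} {m : ℕ} (f : X → X) (A : X → Matrix (Fin m) (Fin m) ℝ) :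
    ℕ → X → Matrix (Fin m) (Fin m) ℝ
  | 0, _ => 1
  | n + 1, x => A (f^[n] x) * cocycle f A n x

/-- `A` is a uniform cocycle over `f` if `(1/n) log ‖A(n,x)‖` converges uniformly on `X`. -/
def IsUniformCocycle {X : Type*} [TopologicalSpace X] {m : ℕ} (f : X → X)
    (A : X → Matrix (Fin m) (Fin m) ℝ) : Prop :=
  ∃ L : X → ℝ, TendstoUniformly (fun (n : ℕ) (x : X) => Real.log ‖cocycle f A n x‖ / n) L atTop

/-- `A` is a continuous map from `X` to `GL(m,ℝ)`. -/
def ContGL {X : Type*} [TopologicalSpace X] {m : ℕ} (A : X → Matrix (Fin m) (Fin m) ℝ) : Prop :=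
  Continuous A ∧ ∀ x, IsUnit (A x)

/-- `μ` is an `f`-invariant Borel probability measure. -/
def InvProb {X : Type*} [MeasurableSpace X] (f : X → X) (μ : Measure X) : Prop :=
  IsProbabilityMeasure μ ∧ μ.map f = μ

/-- `f` is uniquely ergodic: it has exactly one invariant Borel probability measure. -/
def UniquelyErgodic {X : Type*} [MeasurableSpace X] (f : X → X) : Prop :=
  ∃! μ : Measure X, InvProb f μ

/-- `f` is uniquely ergodic with unique invariant Borel probability measure `μ`. -/
def UniquelyErgodicWith {X : Type*} [MeasurableSpace X] (f : X → X) (μ : Measure X) : Prop :=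
  InvProb f μ ∧ ∀ ν : Measure X, InvProb f ν → ν = μ

/-- `f` is totally uniquely ergodic: every positive power of `f` is uniquely ergodic. -/
def TotallyUniquelyErgodic {X : Type*} [MeasurableSpace X] (f : X → X) : Prop :=
  ∀ n : ℕ, 0 < n → UniquelyErgodic (f^[n])

/-- Topological transitivity. -/
def TopTransitive {X : Type*} [TopologicalSpace X] (f : X → X) : Prop :=
  ∀ U V : Set X, IsOpen U → IsOpen V → U.Nonempty → V.Nonempty →
    ∃ k : ℕ, 0 < k ∧ (f^[k] '' U ∩ V).Nonempty

/-- Total transitivity: every positive power is topologically transitive. -/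
def TotallyTransitive {X : Type*} [TopologicalSpace X] (f : X → X) : Prop :=
  ∀ n : ℕ, 0 < n → TopTransitive (f^[n])

/-- Topological weak mixing: `f × f` is topologically transitive. -/
def TopWeaklyMixing {X : Type*} [TopologicalSpace X] (f : X → X) : Prop :=
  TopTransitive (Prod.map f f)

/-- Topological mixing. -/
def TopMixing {X : Type*} [TopologicalSpace X] (f : X → X) : Prop :=
  ∀ U V : Set X, IsOpen U → IsOpen V → U.Nonempty → V.Nonempty →
    ∃ N : ℕ, 0 < N ∧ ∀ k ≥ N, (f^[k] '' U ∩ V).Nonempty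

/-- Minimality: every forward orbit is dense. -/
def MinimalSys {X : Type*} [TopologicalSpace X] (f : X → X) : Prop :=
  ∀ x : X, Dense (Set.range fun n : ℕ => f^[n] x)

/-- The `(n+1)`-th empirical measure `E_{f,n+1}(x) = (1/(n+1)) ∑_{i=0}^{n} δ_{f^i x}`,
as a Borel probability measure. -/
def empPM {X : Type*} [TopologicalSpace X] [MeasurableSpace X]
    (f : X → X) (x : X) (n : ℕ) : ProbabilityMeasure X :=
  ⟨((n + 1 : ℕ) : ℝ≥0∞)⁻¹ • ∑ i ∈ Finset.range (n + 1), Measure.dirac (f^[i] x), by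
    constructor
    simp [Measure.smul_apply, Measure.coe_finset_sum, Finset.sum_apply]
    rw [ENNReal.inv_mul_cancel] <;> simp⟩

/-- `V_f(x)`: the set of weak* accumulation points of the empirical measures of `x`. -/
def VSet {X : Type*} [TopologicalSpace X] [MeasurableSpace X] [OpensMeasurableSpace X]
    (f : X → X) (x : X) : Set (ProbabilityMeasure X) :=
  {ν | MapClusterPt ν atTop (empPM f x)}

/-- `G_{f,μ}`: the set of generic points of `μ` for `f`. -/
def genericPts {X : Type*} [TopologicalSpace X] [MeasurableSpace X] [OpensMeasurableSpace X]
    (f : X → X) (μ : ProbabilityMeasure X) : Set X :=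
  {x | VSet f x = {μ}}

/-- `Q_f^e(X)`: the union of the sets of generic points over all `f`-ergodic
Borel probability measures. -/
def QeSet {X : Type*} [TopologicalSpace X] [MeasurableSpace X] [OpensMeasurableSpace X]
    (f : X → X) : Set X :=
  ⋃ μ ∈ {μ : ProbabilityMeasure X | Ergodic f μ.toMeasure}, genericPts f μ

section ErgodicPowers

variable {X : Type*} [MeasurableSpace X] {f : X → X} {μ : Measure X}

/-- A bounded measurable eigenfunction of `f` for a nontrivial root of unity vanishes almost
everywhere when all prime powers of `f` are ergodic. -/
lemma ae_eq_zero_of_eigenfunction (hf : MeasurePreserving f μ μ)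
    (h : ∀ p : ℕ, p.Prime → Ergodic f^[p] μ) {n : ℕ} (hn : 0 < n) {ζ : ℂ} (hζ : ζ ^ n = 1)
    (hζ1 : ζ ≠ 1) {u : X → ℂ} (hu : Measurable u) (heig : ∀ x, ζ * u (f x) = u x) :
    ∀ᵐ x ∂μ, u x = 0 := by
  have hd : orderOf ζ ∣ n := orderOf_dvd_of_pow_eq_one hζ
  have hd0 : 0 < orderOf ζ := Nat.pos_of_dvd_of_pos hd hn
  have hd1 : orderOf ζ ≠ 1 := by rwa [Ne, orderOf_eq_one_iff]
  have hp := Nat.minFac_prime hd1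
  obtain ⟨e, he⟩ := Nat.minFac_dvd (orderOf ζ)
  set p := (orderOf ζ).minFac
  have he0 : e ≠ 0 := by rintro rfl; omega
  have hlt : e < orderOf ζ := by rw [he]; nlinarith [hp.two_le, Nat.pos_of_ne_zero he0]
  have hη1 : ζ ^ e ≠ 1 := pow_ne_one_of_lt_orderOf he0 hlt
  have hηp : (ζ ^ e) ^ p = 1 := by rw [← pow_mul, mul_comm, ← he, pow_orderOf_eq_one]
  have hstep : ∀ x, ζ ^ e * u (f x) ^ e = u x ^ e := fun x ↦ by rw [← mul_pow, heig]
  have hiter : ∀ k x, (ζ ^ e) ^ k * u (f^[k] x) ^ e = u x ^ e := by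
    intro k
    induction k with
    | zero => simp
    | succ k ih =>
      intro x
      rw [Function.iterate_succ_apply', pow_succ, mul_assoc, hstep, ih]
  obtain ⟨c, hc⟩ := (h p hp).toPreErgodic.ae_eq_const_of_ae_eq_comp (g := fun x ↦ u x ^ e)
    (hu.pow_const e) (by ext x; simpa [hηp] using hiter p x)
  filter_upwards [hc, hf.quasiMeasurePreserving.ae hc] with x hx hfx
  simp only [Function.const_apply] at hx hfx
  have h0 := hstep x
  rw [hx, hfx] at h0
  have : c = 0 := by
    by_contra hc0
    exact hη1 (mul_right_cancel₀ hc0 (by rw [h0, one_mul]))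
  rw [this] at hx
  exact pow_eq_zero_iff he0 |>.1 hx

lemma ergodic_iterate_of_forall_prime (hf : MeasurePreserving f μ μ)
    (h : ∀ p : ℕ, p.Prime → Ergodic f^[p] μ) {n : ℕ} (hn : 0 < n) : Ergodic f^[n] μ := by
  refine ⟨hf.iterate n, ⟨fun s hs hinv ↦ ?_⟩⟩
  let g : X → ℂ := s.indicator 1
  have hg : Measurable g := measurable_one.indicator hs
  have hgn : ∀ x, g (f^[n] x) = g x := fun x ↦ by
    have : f^[n] x ∈ s ↔ x ∈ s := by rw [← mem_preimage, hinv]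
    by_cases hx : x ∈ s <;> simp [g, this, hx]
  let u : ℂ → X → ℂ := fun ζ x ↦ ∑ k ∈ Finset.range n, ζ ^ k * g (f^[k] x)
  have hu : ∀ ζ, Measurable (u ζ) := fun ζ ↦ Finset.measurable_sum _ fun k _ ↦
    (hg.comp (hf.measurable.iterate k)).const_mul _
  have heig : ∀ ζ : ℂ, ζ ^ n = 1 → ∀ x, ζ * u ζ (f x) = u ζ x := by
    intro ζ hζ x
    have h1 := Finset.sum_range_succ (fun k ↦ ζ ^ k * g (f^[k] x)) n
    rw [Finset.sum_range_succ'] at h1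
    simp only [hζ, hgn, pow_zero, Function.iterate_zero, id, one_mul, add_left_inj] at h1
    simp only [u, ← h1, Finset.mul_sum]
    exact Finset.sum_congr rfl fun k _ ↦ by rw [Function.iterate_succ_apply, pow_succ]; ring
  obtain ⟨c, hc⟩ : ∃ c, u 1 =ᵐ[μ] Function.const X c :=
    (h 2 Nat.prime_two).toPreErgodic.ae_eq_const_of_ae_eq_comp (hu 1) <| by
      have := heig 1 (one_pow n)
      simp only [one_mul] at this
      ext x
      simp [this]
  let ω : ℂ := Complex.exp (2 * Real.pi * Complex.I / n)
  have hω : IsPrimitiveRoot ω n := Complex.isPrimitiveRoot_exp n hn.ne'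
  have hzero : ∀ᵐ x ∂μ, ∀ j ∈ Finset.Ico 1 n, u (ω ^ j) x = 0 := by
    rw [Finset.eventually_all]
    intro j hj
    rw [Finset.mem_Ico] at hj
    have hj1 : (ω ^ j) ^ n = 1 := by rw [← pow_mul, mul_comm, pow_mul, hω.pow_eq_one, one_pow]
    exact ae_eq_zero_of_eigenfunction hf h hn hj1 (hω.pow_ne_one_of_pos_of_lt (by omega) hj.2)
      (hu _) (heig _ hj1)
  have hsum : ∀ x, ∑ j ∈ Finset.range n, u (ω ^ j) x = n * g x := by
    intro x
    simp only [u]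
    rw [Finset.sum_comm, Finset.sum_eq_single_of_mem 0 (Finset.mem_range.2 hn)]
    · simp
    · intro k hk hk0
      have hk1 : ω ^ k ≠ 1 := hω.pow_ne_one_of_pos_of_lt hk0 (Finset.mem_range.1 hk)
      have hkn : (ω ^ k) ^ n = 1 := by
        rw [← pow_mul, mul_comm, pow_mul, hω.pow_eq_one, one_pow]
      have hgeom := mul_geom_sum (ω ^ k) n
      rw [hkn, sub_self, mul_eq_zero, sub_eq_zero] at hgeom
      rw [← Finset.sum_mul]
      simp_rw [← pow_mul, mul_comm _ k, pow_mul]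
      rw [hgeom.resolve_left hk1, zero_mul]
  have hgc : ∀ᵐ x ∂μ, n * g x = c := by
    filter_upwards [hc, hzero] with x hx hx0
    rw [← hsum, Finset.range_eq_Ico, Finset.sum_eq_sum_Ico_succ_bot hn,
      Finset.sum_eq_zero (by simpa using hx0), add_zero, pow_zero, hx, Function.const_apply]
  have hn0 : (n : ℂ) ≠ 0 := Nat.cast_ne_zero.2 hn.ne'
  rw [eventuallyConst_set]
  by_cases hc0 : c = 0
  · right
    filter_upwards [hgc] with x hx hxs
    simp [g, hxs, hc0, hn0] at hx
  · left
    filter_upwards [hgc] with x hx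
    by_contra hxs
    simp [g, hxs] at hx
    exact hc0 hx.symm

end ErgodicPowers

section Averages

variable {X : Type*} [MeasurableSpace X] {f : X → X}

/-- Averaging an `f^[p]`-invariant measure along `f` gives an `f`-invariant measure. -/
lemma InvProb.average_iterate (hf : Measurable f) {p : ℕ} (hp : 0 < p) {ν : Measure X}
    (hν : InvProb f^[p] ν) :
    InvProb f ((p : ℝ≥0∞)⁻¹ • ∑ i ∈ Finset.range p, ν.map f^[i]) := by
  have := hν.1
  refine ⟨⟨?_⟩, ?_⟩
  · simp only [Measure.smul_apply, Measure.coe_finsetSum, Finset.sum_apply, smul_eq_mul]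
    rw [Finset.sum_congr rfl (g := fun _ ↦ 1) fun i _ ↦ by
      rw [Measure.map_apply (hf.iterate i) MeasurableSet.univ, preimage_univ, measure_univ]]
    simp [ENNReal.inv_mul_cancel, hp.ne']
  · rw [Measure.map_smul, ← Measure.mapₗ_apply_of_measurable hf, map_sum]
    congr 1
    have h1 := Finset.sum_range_succ (fun i ↦ ν.map f^[i]) p
    rw [Finset.sum_range_succ'] at h1
    simp only [hν.2, Function.iterate_zero, Measure.map_id] at h1
    have h2 := Measure.add_left_inj _ _ _ |>.1 h1
    rw [← h2]
    refine Finset.sum_congr rfl fun i _ ↦ ?_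
    rw [Measure.mapₗ_apply_of_measurable hf, Measure.map_map hf (hf.iterate i),
      Function.iterate_succ']

lemma uniquelyErgodic_iterate_of_ergodic (hf : Measurable f) {μ : Measure X}
    (hμ : UniquelyErgodicWith f μ) {n : ℕ} (hn : 0 < n) (he : Ergodic f^[n] μ) :
    UniquelyErgodic f^[n] := by
  have := hμ.1.1
  refine ⟨μ, ⟨hμ.1.1, he.map_eq⟩, fun ν hν ↦ ?_⟩
  have := hν.1
  refine he.eq_of_absolutelyContinuous ⟨hf.iterate n, hν.2⟩ ?_
  rw [← hμ.2 _ (hν.average_iterate hf hn)]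
  intro s hs
  simp only [Measure.smul_apply, Measure.coe_finsetSum, Finset.sum_apply, smul_eq_mul,
    mul_eq_zero, ENNReal.inv_eq_zero, ENNReal.natCast_ne_top, false_or] at hs
  simpa using (Finset.sum_eq_zero_iff.1 hs) 0 (Finset.mem_range.2 hn)

end Averages

section BaireClassOne

variable {X : Type*} [TopologicalSpace X] [BaireSpace X] {u : ℕ → X → ℝ} {F : X → ℝ}

lemma residual_continuousAt_of_tendsto (hu : ∀ n, Continuous (u n))
    (hF : ∀ x, Tendsto (fun n ↦ u n x) atTop (𝓝 (F x))) :
    ∀ᶠ x in residual X, ContinuousAt F x := by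
  let E : ℝ → ℕ → Set X := fun ε N ↦ {x | ∀ n ≥ N, |u n x - u N x| ≤ ε}
  have hE : ∀ ε N, IsClosed (E ε N) := fun ε N ↦ by
    simp only [E, ofPred_forall]
    exact isClosed_iInter fun n ↦ isClosed_iInter fun _ ↦
      isClosed_le (((hu n).sub (hu N)).abs) continuous_const
  have hcover : ∀ ε > 0, ⋃ N, E ε N = univ := fun ε hε ↦ by
    refine eq_univ_of_forall fun x ↦ mem_iUnion.2 ?_
    obtain ⟨N, hN⟩ := Metric.cauchySeq_iff'.1 (hF x).cauchySeq ε hε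
    exact ⟨N, fun n hn ↦ (hN n hn).le⟩
  have hres : ∀ k : ℕ, ∀ᶠ x in residual X, x ∈ ⋃ N, interior (E (1 / (k + 1)) N) := fun k ↦
    residual_of_dense_open (isOpen_iUnion fun _ ↦ isOpen_interior)
      (dense_iUnion_interior_of_closed (hE _) (hcover _ Nat.one_div_pos_of_nat))
  filter_upwards [eventually_countable_forall.2 hres] with x hx
  rw [Metric.continuousAt_iff']
  intro ε hε
  obtain ⟨k, hk⟩ := exists_nat_one_div_lt (show 0 < ε / 3 by positivity)
  obtain ⟨N, hN⟩ := mem_iUnion.1 (hx k)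
  have hclose : ∀ y ∈ E (1 / (k + 1)) N, |F y - u N y| ≤ 1 / (k + 1) := fun y hy ↦
    le_of_tendsto ((hF y).sub_const _).abs (eventually_atTop.2 ⟨N, hy⟩)
  filter_upwards [mem_interior_iff_mem_nhds.1 hN,
    Metric.continuousAt_iff'.1 (hu N).continuousAt (ε / 3) (by positivity)] with y hy hy'
  have h1 := abs_le.1 (hclose y hy)
  have h2 := abs_le.1 (hclose x (interior_subset hN))
  rw [Real.dist_eq, abs_lt] at hy' ⊢
  constructor <;> linarith [h1.1, h1.2, h2.1, h2.2, hy'.1, hy'.2]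

/-- For a transitive map, an invariant pointwise limit of continuous functions is constant on a
residual set. -/
lemma TopTransitive.residual_eq_const [Nonempty X] {g : X → X} (hg : TopTransitive g)
    (hu : ∀ n, Continuous (u n)) (hF : ∀ x, Tendsto (fun n ↦ u n x) atTop (𝓝 (F x)))
    (hinv : ∀ x, F (g x) = F x) : ∃ c, ∀ᶠ x in residual X, F x = c := by
  have hres := residual_continuousAt_of_tendsto hu hF
  obtain ⟨x₀, hx₀⟩ := (dense_of_mem_residual hres).nonempty
  refine ⟨F x₀, hres.mono fun x hx ↦ ?_⟩
  by_contra hne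
  obtain ⟨U, V, hU, hV, hxU, hxV, hUV⟩ := t2_separation hne
  obtain ⟨U', hU', hUo, hxU'⟩ := mem_nhds_iff.1 (hx (hU.mem_nhds hxU))
  obtain ⟨V', hV', hVo, hxV'⟩ := mem_nhds_iff.1 (hx₀ (hV.mem_nhds hxV))
  obtain ⟨k, -, -, ⟨z, hz, rfl⟩, hzV⟩ := hg U' V' hUo hVo ⟨x, hxU'⟩ ⟨x₀, hxV'⟩
  have hk : F (g^[k] z) = F z := by
    have := Function.Semiconj.iterate_right (f := F) (ga := g) (gb := id) hinv k z
    simpa using this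
  exact disjoint_left.1 hUV (hU' hz) (hk ▸ hV' hzV)

end BaireClassOne

section EmpiricalMeasure

variable {X : Type*} [TopologicalSpace X] [MeasurableSpace X] {f g : X → X}

lemma toMeasure_empPM (f : X → X) (x : X) (n : ℕ) :
    (empPM f x n : Measure X) = ((n + 1 : ℕ) : ℝ≥0∞)⁻¹ •
      ∑ i ∈ Finset.range (n + 1), Measure.dirac (f^[i] x) := rfl

lemma map_empPM_of_commute (hg : Measurable g) (hfg : Function.Commute g f) (x : X) (n : ℕ) :
    (empPM f x n).map hg.aemeasurable = empPM f (g x) n := by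
  apply Subtype.ext
  change (empPM f x n : Measure X).map g = (empPM f (g x) n : Measure X)
  rw [toMeasure_empPM, toMeasure_empPM, Measure.map_smul, ← Measure.mapₗ_apply_of_measurable hg,
    map_sum]
  congr 1
  refine Finset.sum_congr rfl fun i _ ↦ ?_
  rw [Measure.mapₗ_apply_of_measurable hg, Measure.map_dirac' hg, (hfg.iterate_right i).eq]

end EmpiricalMeasure

section Generic

variable {X : Type*} [MetricSpace X] [CompactSpace X] [MeasurableSpace X] [BorelSpace X]
  {f : X → X}

lemma tendsto_empPM_of_mem_genericPts {μ : ProbabilityMeasure X} {x : X}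
    (hx : x ∈ genericPts f μ) : Tendsto (empPM f x) atTop (𝓝 μ) :=
  tendsto_nhds_of_unique_mapClusterPt fun ν hν ↦ by
    have : ν ∈ VSet f x := hν
    rwa [show VSet f x = {μ} from hx] at this

lemma integral_empPM (φ : C(X, ℝ)) (x : X) (n : ℕ) : ∫ y, φ y ∂(empPM f x n : Measure X) =
    ((n + 1 : ℕ) : ℝ)⁻¹ * ∑ i ∈ Finset.range (n + 1), φ (f^[i] x) := by
  rw [toMeasure_empPM, integral_smul_measure, integral_finsetSum_measure]
  · simp only [integral_dirac, ENNReal.toReal_inv, ENNReal.toReal_natCast, smul_eq_mul]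
  · intro i _
    exact integrable_dirac (by simp)

lemma continuous_integral_continuousMap (ν : Measure X) [IsProbabilityMeasure ν] :
    Continuous fun φ : C(X, ℝ) ↦ ∫ x, φ x ∂ν := by
  have hφ : ∀ φ : C(X, ℝ), Integrable φ ν := fun φ ↦
    φ.continuous.integrable_of_hasCompactSupport (HasCompactSupport.of_compactSpace _)
  refine LipschitzWith.continuous (K := 1) (LipschitzWith.of_dist_le_mul fun φ ψ ↦ ?_)
  rw [dist_eq_norm, ← integral_sub (hφ φ) (hφ ψ), NNReal.coe_one, one_mul]
  refine (norm_integral_le_of_norm_le_const (C := dist φ ψ) (.of_forall fun x ↦ ?_)).trans (by simp)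
  rw [← dist_eq_norm]
  exact ContinuousMap.dist_apply_le_dist x

lemma measure_eq_of_dense_integral_eq {μ ν : Measure X} [IsProbabilityMeasure μ]
    [IsProbabilityMeasure ν] {S : Set C(X, ℝ)} (hS : Dense S)
    (h : ∀ φ ∈ S, ∫ x, φ x ∂μ = ∫ x, φ x ∂ν) : μ = ν := by
  have heq := Continuous.ext_on hS (continuous_integral_continuousMap μ)
    (continuous_integral_continuousMap ν) h
  exact ext_of_forall_integral_eq_of_IsFiniteMeasure fun φ ↦ congrFun heq φ.toContinuousMap

lemma ergodic_iterate_of_QeSet_eq_univ [Nonempty X] (hf : IsHomeomorph f) {μ : Measure X}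
    (hμ : UniquelyErgodicWith f μ) {p : ℕ} (hp : 0 < p) (htt : TopTransitive f^[p])
    (hQ : QeSet f^[p] = univ) : Ergodic f^[p] μ := by
  have hμp := hμ.1.1
  have hgen : ∀ x, ∃ ν : ProbabilityMeasure X, Ergodic f^[p] (ν : Measure X) ∧
      Tendsto (empPM f^[p] x) atTop (𝓝 ν) := fun x ↦ by
    have hx : x ∈ QeSet f^[p] := hQ ▸ mem_univ x
    simp only [QeSet, mem_iUnion] at hx
    obtain ⟨ν, hν, hx⟩ := hx
    exact ⟨ν, hν, tendsto_empPM_of_mem_genericPts hx⟩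
  choose ν hν hlim using hgen
  have hiter : ∀ i, Continuous f^[i] := hf.continuous.iterate
  have hopen : ∀ i, IsOpenMap f^[i] := fun i ↦ by
    induction i with
    | zero => exact IsOpenMap.id
    | succ i ih => exact ih.comp hf.isOpenMap
  have hmap : ∀ i x, (ν (f^[i] x) : Measure X) = (ν x : Measure X).map f^[i] := fun i x ↦ by
    have h1 := ProbabilityMeasure.tendsto_map_of_tendsto_of_continuous _ _ (hlim x) (hiter i)
    simp only [map_empPM_of_commute (hiter i).measurable
      ((Function.Commute.refl f).iterate_iterate i p)] at h1
    exact congrArg _ (tendsto_nhds_unique (hlim (f^[i] x)) h1)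
  have hconst : ∀ φ : C(X, ℝ), ∃ c, ∀ᶠ x in residual X, ∫ y, φ y ∂(ν x : Measure X) = c := by
    intro φ
    refine htt.residual_eq_const (u := fun n x ↦ ∫ y, φ y ∂(empPM f^[p] x n : Measure X))
      (fun n ↦ ?_) (fun x ↦ ?_) fun x ↦ ?_
    · simp only [integral_empPM]
      exact continuous_const.mul <| continuous_finsetSum _ fun i _ ↦
        φ.continuous.comp ((hiter p).iterate i)
    · exact ProbabilityMeasure.tendsto_iff_forall_integral_tendsto.1 (hlim x)
        (BoundedContinuousFunction.mkOfCompact φ)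
    · rw [hmap, (hν x).map_eq]
  have hval : ∀ φ : C(X, ℝ), ∀ᶠ x in residual X,
      ∫ y, φ y ∂(ν x : Measure X) = ∫ y, φ y ∂μ := by
    intro φ
    obtain ⟨c, hc⟩ := hconst φ
    have hall : ∀ᶠ x in residual X, ∀ i, ∫ y, φ y ∂(ν (f^[i] x) : Measure X) = c :=
      eventually_countable_forall.2 fun i ↦
        (tendsto_residual_of_isOpenMap (hiter i) (hopen i)).eventually hc
    filter_upwards [hall] with x hx
    have hφ : ∀ i, Integrable φ ((ν x : Measure X).map f^[i]) := fun i ↦ by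
      have := (ν x : Measure X).isProbabilityMeasure_map (hiter i).measurable.aemeasurable
      exact φ.continuous.integrable_of_hasCompactSupport (HasCompactSupport.of_compactSpace _)
    have hνx : InvProb f^[p] (ν x : Measure X) := ⟨inferInstance, (hν x).map_eq⟩
    rw [← hμ.2 _ (hνx.average_iterate hf.continuous.measurable hp), integral_smul_measure,
      integral_finsetSum_measure fun i _ ↦ hφ i]
    simp only [← hmap, hx]
    have hx0 := hx 0
    rw [Function.iterate_zero_apply] at hx0
    simp [hx0, hp.ne']
  have hall : ∀ᶠ x in residual X, ∀ k, ∫ y, TopologicalSpace.denseSeq C(X, ℝ) k y ∂(ν x : Measure X)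
      = ∫ y, TopologicalSpace.denseSeq C(X, ℝ) k y ∂μ :=
    eventually_countable_forall.2 fun k ↦ hval _
  obtain ⟨x, hx⟩ := (dense_of_mem_residual hall).nonempty
  have hνμ : (ν x : Measure X) = μ :=
    measure_eq_of_dense_integral_eq (TopologicalSpace.denseRange_denseSeq C(X, ℝ))
      (forall_mem_range.2 hx)
  exact hνμ ▸ hν x

end Generic

/-- Theorem D: a totally transitive, uniquely ergodic but not totally uniquely ergodic
dynamical system has a prime `p` with `Q_{f^p}^e(X) ≠ X`. -/
theorem exists_prime_QeSet_ne_univ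
    {X : Type*} [MetricSpace X] [CompactSpace X] [MeasurableSpace X] [BorelSpace X]
    (f : X → X) (hf : IsHomeomorph f) (htt : TotallyTransitive f)
    (hue : UniquelyErgodic f) (hntue : ¬ TotallyUniquelyErgodic f) :
    ∃ p : ℕ, p.Prime ∧ QeSet (f^[p]) ≠ Set.univ := by
  obtain ⟨μ, hμ⟩ : ∃ μ, UniquelyErgodicWith f μ := hue
  have := hμ.1.1
  have : Nonempty X := nonempty_of_isProbabilityMeasure μ
  have hfm := hf.continuous.measurable
  by_contra! hQ
  refine hntue fun n hn ↦ uniquelyErgodic_iterate_of_ergodic hfm hμ hn ?_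
  exact ergodic_iterate_of_forall_prime ⟨hfm, hμ.1.2⟩ (fun p hp ↦
    ergodic_iterate_of_QeSet_eq_univ hf hμ hp.pos (htt p hp.pos) (hQ p hp)) hn
end
end

section
/- Let (X,μ,f) be a uniquely ergodic dynamical system. If there exist m ≥ 1 and a non-uniform A ∈ C(X, GL(m,ℝ)), then for every p ≥ m there exists a non-uniform B ∈ C(X, GL(p,ℝ)). -/
open MeasureTheory Filter Topology Set
open scoped ENNReal NNReal

attribute [local instance] Matrix.normedAddCommGroup

noncomputable section

theorem Matrix.norm_mul_le_card_mul {m : ℕ} (M N : Matrix (Fin m) (Fin m) ℝ) :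
    ‖M * N‖ ≤ m * ‖M‖ * ‖N‖ := by
  refine (Matrix.norm_le_iff (by positivity)).2 fun i j => ?_
  rw [Matrix.mul_apply]
  calc ‖∑ l, M i l * N l j‖ ≤ ∑ _l : Fin m, ‖M‖ * ‖N‖ := by
        refine norm_sum_le_of_le _ fun l _ => ?_
        rw [norm_mul]
        exact mul_le_mul (Matrix.norm_entry_le_entrywise_sup_norm M)
          (Matrix.norm_entry_le_entrywise_sup_norm N) (norm_nonneg _) (norm_nonneg _)
    _ = m * ‖M‖ * ‖N‖ := by simp [mul_assoc]

/-- The norm of an invertible continuous cocycle over a compact space decays at most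
exponentially, uniformly in the base point. -/
theorem ContGL.exists_pow_le_norm_cocycle {X : Type*} [TopologicalSpace X] [CompactSpace X]
    {m : ℕ} (hm : 1 ≤ m) (f : X → X) {A : X → Matrix (Fin m) (Fin m) ℝ} (hA : ContGL A) :
    ∃ c : ℝ, 0 < c ∧ ∀ n x, c ^ n ≤ ‖cocycle f A n x‖ := by
  have hdet : ∀ x, (A x).det ≠ 0 := fun x =>
    ((Matrix.isUnit_iff_isUnit_det _).1 (hA.2 x)).ne_zero
  have hcont : Continuous fun x => (A x)⁻¹ := by
    simp only [Matrix.inv_def, Ring.inverse_eq_inv']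
    exact (hA.1.matrix_det.inv₀ hdet).smul hA.1.matrix_adjugate
  obtain ⟨K, hK⟩ := isCompact_univ.exists_bound_of_continuousOn hcont.continuousOn
  have hm' : (0 : ℝ) < m := by exact_mod_cast hm
  have hL : 0 < m * max K 1 := by positivity
  refine ⟨(m * max K 1)⁻¹, inv_pos.2 hL, fun n x => ?_⟩
  induction n with
  | zero =>
    simpa [cocycle] using
      Matrix.norm_entry_le_entrywise_sup_norm (1 : Matrix (Fin m) (Fin m) ℝ)
        (i := ⟨0, hm⟩) (j := ⟨0, hm⟩)
  | succ n ih =>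
    rw [pow_succ', inv_mul_le_iff₀ hL]
    refine ih.trans ?_
    calc ‖cocycle f A n x‖ = ‖(A (f^[n] x))⁻¹ * cocycle f A (n + 1) x‖ := by
          rw [cocycle, Matrix.nonsing_inv_mul_cancel_left _ _ (hdet _).isUnit]
      _ ≤ m * ‖(A (f^[n] x))⁻¹‖ * ‖cocycle f A (n + 1) x‖ := Matrix.norm_mul_le_card_mul _ _
      _ ≤ m * max K 1 * ‖cocycle f A (n + 1) x‖ := by
          gcongr
          exact (hK _ (mem_univ _)).trans (le_max_left _ _)

/-- The block diagonal matrix with blocks `M` and `c • 1`. -/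
def scalarExtension {m : ℕ} (k : ℕ) (c : ℝ) (M : Matrix (Fin m) (Fin m) ℝ) :
    Matrix (Fin (m + k)) (Fin (m + k)) ℝ :=
  Matrix.reindexAlgEquiv ℝ ℝ finSumFinEquiv
    (Matrix.fromBlocks M 0 0 (c • (1 : Matrix (Fin k) (Fin k) ℝ)))

theorem scalarExtension_mul {m : ℕ} (k : ℕ) (c d : ℝ) (M N : Matrix (Fin m) (Fin m) ℝ) :
    scalarExtension k c M * scalarExtension k d N = scalarExtension k (c * d) (M * N) := by
  rw [scalarExtension, scalarExtension, scalarExtension, ← map_mul, Matrix.fromBlocks_multiply]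
  simp [smul_smul, mul_comm]

theorem scalarExtension_one {m : ℕ} (k : ℕ) :
    scalarExtension k 1 (1 : Matrix (Fin m) (Fin m) ℝ) = 1 := by
  rw [scalarExtension, one_smul, Matrix.fromBlocks_one, map_one]

theorem norm_scalarExtension {m : ℕ} (k : ℕ) {c : ℝ} {M : Matrix (Fin m) (Fin m) ℝ}
    (hc : |c| ≤ ‖M‖) : ‖scalarExtension k c M‖ = ‖M‖ := by
  apply le_antisymm
  · refine (Matrix.norm_le_iff (norm_nonneg _)).2 fun i j => ?_
    obtain ⟨i, rfl⟩ := finSumFinEquiv.surjective i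
    obtain ⟨j, rfl⟩ := finSumFinEquiv.surjective j
    simp only [scalarExtension, Matrix.coe_reindexAlgEquiv, Matrix.reindex_apply,
      Matrix.submatrix_apply, Equiv.symm_apply_apply]
    rcases i with i | i <;> rcases j with j | j
    · exact Matrix.norm_entry_le_entrywise_sup_norm M
    · simp
    · simp
    · by_cases h : i = j
      · simpa [h] using hc
      · simp [Matrix.one_apply_ne h]
  · refine (Matrix.norm_le_iff (norm_nonneg _)).2 fun i j => ?_
    simpa [scalarExtension] using
      Matrix.norm_entry_le_entrywise_sup_norm (scalarExtension k c M)
        (i := finSumFinEquiv (Sum.inl i)) (j := finSumFinEquiv (Sum.inl j))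

theorem cocycle_scalarExtension {X : Type*} {m : ℕ} (k : ℕ) (c : ℝ) (f : X → X)
    (A : X → Matrix (Fin m) (Fin m) ℝ) (n : ℕ) (x : X) :
    cocycle f (fun y => scalarExtension k c (A y)) n x =
      scalarExtension k (c ^ n) (cocycle f A n x) := by
  induction n with
  | zero => simp [cocycle, scalarExtension_one]
  | succ n ih => rw [cocycle, ih, scalarExtension_mul, ← pow_succ', cocycle]

theorem ContGL.comp_scalarExtension {X : Type*} [TopologicalSpace X] {m : ℕ} (k : ℕ) {c : ℝ}
    (hc : c ≠ 0) {A : X → Matrix (Fin m) (Fin m) ℝ} (hA : ContGL A) :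
    ContGL fun x => scalarExtension k c (A x) := by
  refine ⟨?_, fun x => ?_⟩
  · exact (hA.1.matrix_fromBlocks continuous_const continuous_const
      continuous_const).matrix_submatrix _ _
  · obtain ⟨u, hu⟩ := hA.2 x
    refine IsUnit.of_mul_eq_one (scalarExtension k c⁻¹ ↑u⁻¹) ?_
    beta_reduce
    rw [← hu, scalarExtension_mul, mul_inv_cancel₀ hc, Units.mul_inv, scalarExtension_one]

/-- Proposition 2.7: if a uniquely ergodic system has a non-uniform continuous
`GL(m,ℝ)`-cocycle, then it has a non-uniform continuous `GL(p,ℝ)`-cocycle for every `p ≥ m`. -/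
theorem exists_nonuniform_cocycle_of_le
    {X : Type*} [MetricSpace X] [CompactSpace X] [MeasurableSpace X] [BorelSpace X]
    (f : X → X) (hf : IsHomeomorph f) (μ : Measure X) (hue : UniquelyErgodicWith f μ)
    (m : ℕ) (hm : 1 ≤ m) (A : X → Matrix (Fin m) (Fin m) ℝ)
    (hA : ContGL A) (hAnu : ¬ IsUniformCocycle f A)
    (p : ℕ) (hp : m ≤ p) :
    ∃ B : X → Matrix (Fin p) (Fin p) ℝ, ContGL B ∧ ¬ IsUniformCocycle f B := by
  obtain ⟨k, rfl⟩ := Nat.exists_eq_add_of_le hp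
  obtain ⟨c, hc, hle⟩ := hA.exists_pow_le_norm_cocycle hm f
  refine ⟨fun x => scalarExtension k c (A x), hA.comp_scalarExtension k hc.ne', fun hB => hAnu ?_⟩
  have hnorm : ∀ n x, ‖cocycle f (fun y => scalarExtension k c (A y)) n x‖ =
      ‖cocycle f A n x‖ := fun n x => by
    rw [cocycle_scalarExtension, norm_scalarExtension]
    rw [abs_of_pos (pow_pos hc n)]
    exact hle n x
  simpa only [IsUniformCocycle, hnorm] using hB
end
end

section
/- Let (X,μ,f) be uniquely ergodic and suppose (X,μ,f^d) is not uniquely ergodic for some d ≥ 2. Then there exists an f^d-ergodic Borel probability measure ν such that the set of f^d-ergodic measures equals {ν ∘ f^{-i} : 0 ≤ i ≤ d−1} and μ = (1/d) ∑_{i=0}^{d-1} ν ∘ f^{-i}. -/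
open MeasureTheory Filter Topology Set
open scoped ENNReal NNReal

attribute [local instance] Matrix.normedAddCommGroup

noncomputable section

theorem MeasureTheory.MeasurePreserving.cond_of_preimage_eq {X : Type*} [MeasurableSpace X]
    {g : X → X} {μ : Measure X} (hg : MeasurePreserving g μ μ) {A : Set X} (hA : MeasurableSet A)
    (hgA : g ⁻¹' A = A) :
    MeasurePreserving g (ProbabilityTheory.cond μ A) (ProbabilityTheory.cond μ A) := by
  have h := hg.restrict_preimage hA
  rw [hgA] at h
  exact h.smul_measure _

/-- The average of the first `d` pushforwards of an `f^[d]`-invariant probability measure is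
`f`-invariant. -/
theorem invProb_average {X : Type*} [MeasurableSpace X] {f : X → X} (hf : Measurable f)
    {d : ℕ} (hd : d ≠ 0) {ν : Measure X} [IsProbabilityMeasure ν]
    (hν : MeasurePreserving (f^[d]) ν ν) :
    InvProb f ((d : ℝ≥0∞)⁻¹ • ∑ i ∈ Finset.range d, ν.map (f^[i])) := by
  constructor
  · constructor
    have h (i : ℕ) : ν.map (f^[i]) univ = 1 := by
      rw [Measure.map_apply (hf.iterate i) .univ, preimage_univ, measure_univ]
    simp only [Measure.smul_apply, Measure.finsetSum_apply, h, Finset.sum_const,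
      Finset.card_range, smul_eq_mul, nsmul_eq_mul, mul_one]
    exact ENNReal.inv_mul_cancel (by exact_mod_cast hd) (ENNReal.natCast_ne_top d)
  · ext s hs
    rw [Measure.map_apply hf hs]
    simp only [Measure.smul_apply, Measure.finsetSum_apply]
    congr 1
    have h (i : ℕ) : ν.map (f^[i]) (f ⁻¹' s) = ν.map (f^[i + 1]) s := by
      rw [Measure.map_apply (hf.iterate i) (hf hs), Measure.map_apply (hf.iterate _) hs,
        Function.iterate_succ', preimage_comp]
    simp only [h]
    have h₁ := Finset.sum_range_succ (fun i => ν.map (f^[i]) s) d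
    rw [Finset.sum_range_succ', hν.map_eq, Function.iterate_zero, Measure.map_id] at h₁
    exact (ENNReal.add_left_inj (measure_ne_top ν s)).1 h₁

theorem UniquelyErgodicWith.measure_compl_eq_zero {X : Type*} [MeasurableSpace X] {f : X → X}
    {μ : Measure X} (hue : UniquelyErgodicWith f μ) (hf : Measurable f) {B : Set X}
    (hB : MeasurableSet B) (hfB : f ⁻¹' B = B) (h₀ : μ B ≠ 0) : μ Bᶜ = 0 := by
  have := hue.1.1
  have hp := ProbabilityTheory.cond_isProbabilityMeasure h₀
  have h := hue.2 _ ⟨hp,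
    (MeasurePreserving.cond_of_preimage_eq ⟨hf, hue.1.2⟩ hB hfB).map_eq⟩
  rw [← h, ProbabilityTheory.cond_apply hB, inter_compl_self, measure_empty, mul_zero]

theorem preimage_biUnion_iterate_eq {X : Type*} {f : X → X} {d : ℕ} (hd : d ≠ 0) {A : Set X}
    (hA : f^[d] ⁻¹' A = A) :
    f ⁻¹' (⋃ i ∈ Finset.range d, f^[i] ⁻¹' A) = ⋃ i ∈ Finset.range d, f^[i] ⁻¹' A := by
  have hA' (x : X) : f^[d] x ∈ A ↔ x ∈ A := by rw [← mem_preimage, hA]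
  ext x
  simp only [mem_preimage, mem_iUnion, Finset.mem_range, exists_prop, ← Function.iterate_succ_apply]
  constructor
  · rintro ⟨i, hi, hx⟩
    obtain h | h := Nat.lt_or_ge (i + 1) d
    · exact ⟨i + 1, h, hx⟩
    · obtain rfl : d = i + 1 := by omega
      exact ⟨0, by omega, (hA' x).1 hx⟩
  · rintro ⟨i, hi, hx⟩
    cases i with
    | zero => exact ⟨d - 1, by omega, by
        rw [Nat.succ_eq_add_one, Nat.sub_add_cancel (by omega)]; exact (hA' x).2 hx⟩
    | succ i => exact ⟨i, by omega, hx⟩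

theorem preimage_iterate_preimage_eq {X : Type*} {f : X → X} {d : ℕ} {A : Set X}
    (hA : f^[d] ⁻¹' A = A) (i : ℕ) : f^[d] ⁻¹' (f^[i] ⁻¹' A) = f^[i] ⁻¹' A := by
  rw [← preimage_comp, ← Function.iterate_add, Nat.add_comm, Function.iterate_add, preimage_comp,
    hA]

theorem measurableSet_biUnion_preimage_iterate {X : Type*} [MeasurableSpace X] {f : X → X}
    (hf : Measurable f) (d : ℕ) {A : Set X} (hA : MeasurableSet A) :
    MeasurableSet (⋃ i ∈ Finset.range d, f^[i] ⁻¹' A) :=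
  Finset.measurableSet_biUnion _ fun i _ => hf.iterate i hA

theorem UniquelyErgodicWith.measure_compl_biUnion_eq_zero {X : Type*} [MeasurableSpace X]
    {f : X → X} {μ : Measure X} (hue : UniquelyErgodicWith f μ) (hf : Measurable f) {d : ℕ}
    (hd : d ≠ 0) {A : Set X} (hA : MeasurableSet A) (hfA : f^[d] ⁻¹' A = A) (h₀ : μ A ≠ 0) :
    μ (⋃ i ∈ Finset.range d, f^[i] ⁻¹' A)ᶜ = 0 := by
  refine hue.measure_compl_eq_zero hf (measurableSet_biUnion_preimage_iterate hf d hA)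
    (preimage_biUnion_iterate_eq hd hfA) fun h => h₀ (measure_mono_null (fun x hx => ?_) h)
  simp only [mem_iUnion, Finset.mem_range, exists_prop]
  exact ⟨0, by omega, hx⟩

theorem UniquelyErgodicWith.inv_le_measure {X : Type*} [MeasurableSpace X] {f : X → X}
    {μ : Measure X} (hue : UniquelyErgodicWith f μ) (hf : Measurable f) {d : ℕ} (hd : d ≠ 0)
    {A : Set X} (hA : MeasurableSet A) (hfA : f^[d] ⁻¹' A = A) (h₀ : μ A ≠ 0) :
    (d : ℝ≥0∞)⁻¹ ≤ μ A := by
  have := hue.1.1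
  have hmp : MeasurePreserving f μ μ := ⟨hf, hue.1.2⟩
  have hB₁ : μ (⋃ i ∈ Finset.range d, f^[i] ⁻¹' A) = 1 :=
    (prob_compl_eq_zero_iff (measurableSet_biUnion_preimage_iterate hf d hA)).1
      (hue.measure_compl_biUnion_eq_zero hf hd hA hfA h₀)
  have h₁ : (1 : ℝ≥0∞) ≤ d * μ A := by
    calc (1 : ℝ≥0∞) = μ (⋃ i ∈ Finset.range d, f^[i] ⁻¹' A) := hB₁.symm
      _ ≤ ∑ i ∈ Finset.range d, μ (f^[i] ⁻¹' A) := measure_biUnion_finset_le _ _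
      _ = d * μ A := by
        simp [fun i => (hmp.iterate i).measure_preimage hA.nullMeasurableSet]
  rw [ENNReal.inv_le_iff_le_mul (by simp) (by simp)]
  rwa [mul_comm] at h₁ ⊢

/-- If the nonnull invariant sets have measure bounded below, then conditioning on a suitable
invariant set yields an ergodic measure. -/
theorem MeasureTheory.MeasurePreserving.exists_ergodic_cond {X : Type*} [MeasurableSpace X]
    {g : X → X} {μ : Measure X} [IsProbabilityMeasure μ] (hg : MeasurePreserving g μ μ) {c : ℝ≥0∞}
    (hc : c ≠ 0)
    (hbound : ∀ A, MeasurableSet A → g ⁻¹' A = A → μ A ≠ 0 → c ≤ μ A) :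
    ∃ A, MeasurableSet A ∧ g ⁻¹' A = A ∧ μ A ≠ 0 ∧ Ergodic g (ProbabilityTheory.cond μ A) := by
  set S : Set (Set X) := {A | MeasurableSet A ∧ g ⁻¹' A = A ∧ μ A ≠ 0}
  set m : ℝ≥0∞ := ⨅ A ∈ S, μ A
  have hcm : c ≤ m := le_iInf₂ fun A hA => hbound A hA.1 hA.2.1 hA.2.2
  have hm₀ : m ≠ 0 := fun h => hc (by simpa [h] using hcm)
  have hm₁ : m ≤ 1 := (iInf₂_le univ ⟨.univ, rfl, by simp⟩).trans prob_le_one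
  have hlt : m < m + m := ENNReal.lt_add_right (hm₁.trans_lt ENNReal.one_lt_top).ne hm₀
  obtain ⟨A, hA, hAm⟩ : ∃ A ∈ S, μ A < m + m := by
    simpa only [m, iInf_lt_iff, exists_prop] using hlt
  refine ⟨A, hA.1, hA.2.1, hA.2.2, hg.cond_of_preimage_eq hA.1 hA.2.1, ⟨fun s hs hgs => ?_⟩⟩
  have key : μ (A ∩ s) = 0 ∨ μ (A ∩ sᶜ) = 0 := by
    by_contra! h
    have h₁ : m ≤ μ (A ∩ s) := iInf₂_le (A ∩ s)
      ⟨hA.1.inter hs, by rw [preimage_inter, hA.2.1, hgs], h.1⟩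
    have h₂ : m ≤ μ (A ∩ sᶜ) := iInf₂_le (A ∩ sᶜ)
      ⟨hA.1.inter hs.compl, by rw [preimage_inter, preimage_compl, hA.2.1, hgs], h.2⟩
    have h₃ : μ (A ∩ s) + μ (A ∩ sᶜ) = μ A := by
      rw [← sdiff_eq, measure_inter_add_sdiff A hs]
    exact (hAm.trans_le (add_le_add h₁ h₂)).ne h₃.symm
  rw [eventuallyConst_set']
  refine key.imp (fun h => ?_) fun h => ?_
  · rw [ae_eq_empty, ProbabilityTheory.cond_apply hA.1, h, mul_zero]
  · rw [ae_eq_univ, ProbabilityTheory.cond_apply hA.1, h, mul_zero]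

theorem Ergodic.map_iterate {X : Type*} [MeasurableSpace X] {f : X → X} (hf : Measurable f)
    {d : ℕ} {ν : Measure X} (hν : Ergodic (f^[d]) ν) (i : ℕ) :
    Ergodic (f^[d]) (ν.map (f^[i])) :=
  ((hf.iterate i).measurePreserving ν).ergodic_of_ergodic_semiconj hν (hf.iterate d)
    (Function.Commute.iterate_iterate_self f i d)

/-- Lemma 2.8: if `(X,μ,f)` is uniquely ergodic but `f^d` is not uniquely ergodic for some
`d ≥ 2`, then the `f^d`-ergodic measures are exactly the pushforwards `ν ∘ f^{-i}`,
`0 ≤ i ≤ d-1`, of a single `f^d`-ergodic measure `ν`, and `μ` is their average. -/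
theorem ergodic_measures_of_pow_eq_orbit
    {X : Type*} [MetricSpace X] [CompactSpace X] [MeasurableSpace X] [BorelSpace X]
    (f : X → X) (hf : IsHomeomorph f) (μ : Measure X) (hue : UniquelyErgodicWith f μ)
    (d : ℕ) (hd : 2 ≤ d) (hnue : ¬ UniquelyErgodic (f^[d])) :
    ∃ ν : Measure X, IsProbabilityMeasure ν ∧ Ergodic (f^[d]) ν ∧
      {ρ : Measure X | IsProbabilityMeasure ρ ∧ Ergodic (f^[d]) ρ} =
        {ρ : Measure X | ∃ i < d, ρ = ν.map (f^[i])} ∧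
      μ = ((d : ℝ≥0∞))⁻¹ • ∑ i ∈ Finset.range d, ν.map (f^[i]) := by
  have hd₀ : d ≠ 0 := by omega
  have hfm : Measurable f := hf.continuous.measurable
  have := hue.1.1
  have hmp : MeasurePreserving f μ μ := ⟨hfm, hue.1.2⟩
  obtain ⟨A, hA, hfA, hA₀, hν⟩ := (hmp.iterate d).exists_ergodic_cond
    (ENNReal.inv_ne_zero.2 (ENNReal.natCast_ne_top d))
    fun A hA hfA h₀ => hue.inv_le_measure hfm hd₀ hA hfA h₀
  set ν := ProbabilityTheory.cond μ A with hνdef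
  have hνp : IsProbabilityMeasure ν := ProbabilityTheory.cond_isProbabilityMeasure hA₀
  refine ⟨ν, hνp, hν, ?_, (hue.2 _ (invProb_average hfm hd₀ hν.toMeasurePreserving)).symm⟩
  ext ρ
  constructor
  · rintro ⟨hρp, hρ⟩
    have hac (i : ℕ) (hi : i < d) : ρ.map (f^[i]) ≪ μ := by
      refine Measure.AbsolutelyContinuous.mk fun s _ h => ?_
      rw [← hue.2 _ (invProb_average hfm hd₀ hρ.toMeasurePreserving)] at h
      simp only [Measure.smul_apply, Measure.finsetSum_apply, smul_eq_mul, mul_eq_zero,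
        ENNReal.inv_eq_zero, ENNReal.natCast_ne_top, false_or, Finset.sum_eq_zero_iff,
        Finset.mem_range] at h
      exact h i hi
    obtain ⟨i, hi, hρi⟩ : ∃ i < d, ρ (f^[i] ⁻¹' A) ≠ 0 := by
      by_contra! h
      have hc : ρ (⋃ i ∈ Finset.range d, f^[i] ⁻¹' A)ᶜ = 0 := by
        simpa using hac 0 (by omega) (hue.measure_compl_biUnion_eq_zero hfm hd₀ hA hfA hA₀)
      have hu : ρ (⋃ i ∈ Finset.range d, f^[i] ⁻¹' A) = 0 := by
        simpa [measure_iUnion_null_iff] using h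
      rw [prob_compl_eq_zero_iff (measurableSet_biUnion_preimage_iterate hfm d hA), hu] at hc
      exact zero_ne_one hc
    have hρc : ρ (f^[i] ⁻¹' A)ᶜ = 0 :=
      (hρ.measure_self_or_compl_eq_zero (hfm.iterate i hA)
        (preimage_iterate_preimage_eq hfA i)).resolve_left hρi
    have hacν : ρ.map (f^[i]) ≪ ν := by
      refine Measure.AbsolutelyContinuous.mk fun s hs h => ?_
      rw [hνdef, ProbabilityTheory.cond_apply hA, mul_eq_zero, ENNReal.inv_eq_zero] at h
      have h₁ := hac i hi (h.resolve_left (measure_ne_top μ A))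
      rw [← preimage_compl, ← Measure.map_apply (hfm.iterate i) hA.compl] at hρc
      refine measure_mono_null (fun x hx => ?_) (measure_union_null h₁ hρc)
      by_cases hxA : x ∈ A
      · exact .inl ⟨hxA, hx⟩
      · exact .inr hxA
    have : IsProbabilityMeasure (ρ.map (f^[i])) :=
      Measure.isProbabilityMeasure_map (hfm.iterate i).aemeasurable
    have heq : ρ.map (f^[i]) = ν :=
      hν.eq_of_absolutelyContinuous (hρ.map_iterate hfm i).toMeasurePreserving hacν
    obtain rfl | hi₀ := eq_or_ne i 0
    · exact ⟨0, by omega, by simpa using heq⟩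
    · refine ⟨d - i, by omega, ?_⟩
      rw [← heq, Measure.map_map (hfm.iterate _) (hfm.iterate i), ← Function.iterate_add,
        Nat.sub_add_cancel hi.le, hρ.toMeasurePreserving.map_eq]
  · rintro ⟨i, -, rfl⟩
    exact ⟨Measure.isProbabilityMeasure_map (hfm.iterate i).aemeasurable, hν.map_iterate hfm i⟩
end
end

section
/- Let (X,μ,f) be uniquely ergodic and let p, q be primes such that (X,μ,f^{pq}) is not uniquely ergodic. Then either (X,μ,f^p) is not uniquely ergodic or (X,μ,f^q) is not uniquely ergodic. -/
open MeasureTheory Filter Topology Set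
open scoped ENNReal NNReal

attribute [local instance] Matrix.normedAddCommGroup

noncomputable section

/-- A measure which is the only invariant probability measure of `f` is ergodic. -/
theorem UniquelyErgodicWith.ergodic {X : Type*} [MeasurableSpace X] {f : X → X} {μ : Measure X}
    (h : UniquelyErgodicWith f μ) (hf : Measurable f) : Ergodic f μ := by
  obtain ⟨⟨hμ, hμf⟩, huniq⟩ := h
  refine Ergodic.of_mem_extremePoints ⟨⟨⟨hf, hμf⟩, hμ⟩, ?_⟩
  rintro ν₁ ⟨h₁, h₁'⟩ ν₂ ⟨h₂, h₂'⟩ -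
  exact huniq ν₁ ⟨h₁', h₁.map_eq⟩

theorem InvProb.iterate {X : Type*} [MeasurableSpace X] {f : X → X} {μ : Measure X}
    (h : InvProb f μ) (hf : Measurable f) (n : ℕ) : InvProb f^[n] μ :=
  ⟨h.1, ((⟨hf, h.2⟩ : MeasurePreserving f μ μ).iterate n).map_eq⟩

theorem UniquelyErgodic.uniquelyErgodicWith {X : Type*} [MeasurableSpace X] {f : X → X}
    {μ : Measure X} (h : UniquelyErgodic f) (hμ : InvProb f μ) : UniquelyErgodicWith f μ :=
  ⟨hμ, fun _ hν => h.unique hν hμ⟩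

theorem pow_mul_iterate_of_mul_comp {X : Type*} {f : X → X} {u : X → ℂ} {ω : ℂ}
    (hu : ∀ x, ω * u (f x) = u x) (m : ℕ) (x : X) : ω ^ m * u (f^[m] x) = u x := by
  induction m with
  | zero => simp
  | succ m ih => rw [Function.iterate_succ_apply', pow_succ, mul_assoc, hu, ih]

/-- If `f^p` and `f^q` are ergodic, then an eigenfunction of `f` whose eigenvalue is a `pq`-th root
of unity is a.e. constant. -/
theorem ae_eq_const_of_eigenfunction {X : Type*} [MeasurableSpace X] {f : X → X}
    {μ : Measure X} [IsProbabilityMeasure μ] {p q : ℕ} (hq : q ≠ 0)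
    (hep : Ergodic f^[p] μ) (heq : Ergodic f^[q] μ) (hf : MeasurePreserving f μ μ)
    {u : X → ℂ} (hum : Measurable u) {ω : ℂ} (hω : ω ^ (p * q) = 1)
    (hu : ∀ x, ω * u (f x) = u x) : ∃ c, u =ᵐ[μ] Function.const X c := by
  by_cases hωq : ω ^ q = 1
  · refine heq.toPreErgodic.ae_eq_const_of_ae_eq_comp hum (funext fun x => ?_)
    simpa [hωq] using pow_mul_iterate_of_mul_comp hu q x
  · obtain ⟨c, hc⟩ := hep.toPreErgodic.ae_eq_const_of_ae_eq_comp (hum.pow_const q)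
      (funext fun x => by
        simp only [Function.comp_apply]
        rw [← pow_mul_iterate_of_mul_comp hu p x, mul_pow, ← pow_mul, hω, one_mul])
    have hc₀ : c = 0 := by
      obtain ⟨x, hx, hfx⟩ := (hc.and (hf.quasiMeasurePreserving.ae hc)).exists
      simp only [Function.const_apply] at hx hfx
      have h : ω ^ q * c = c := by
        rw [← hfx, ← mul_pow, hu, hx, hfx]
      by_contra hne
      exact hωq (mul_right_cancel₀ hne (h.trans (one_mul c).symm))
    refine ⟨0, hc.mono fun x hx => ?_⟩
    simpa [hc₀, hq] using hx

theorem mul_twisted_sum_comp {X : Type*} {f : X → X} {n : ℕ} {χ : X → ℂ}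
    (hχ : ∀ x, χ (f^[n] x) = χ x) {ω : ℂ} (hω : ω ^ n = 1) (x : X) :
    ω * ∑ j ∈ Finset.range n, ω ^ j * χ (f^[j] (f x)) =
      ∑ j ∈ Finset.range n, ω ^ j * χ (f^[j] x) := by
  have h₁ := Finset.sum_range_succ (fun j => ω ^ j * χ (f^[j] x)) n
  rw [Finset.sum_range_succ'] at h₁
  simp only [hω, hχ, pow_zero, Function.iterate_zero, id_eq] at h₁
  rw [← add_right_cancel h₁, Finset.mul_sum]
  refine Finset.sum_congr rfl fun j _ => ?_
  rw [Function.iterate_succ_apply, pow_succ']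
  ring

theorem IsPrimitiveRoot.sum_pow_mul_eq_zero {ω : ℂ} {n j : ℕ} (hω : IsPrimitiveRoot ω n)
    (hj : j ≠ 0) (hjn : j < n) : ∑ k ∈ Finset.range n, (ω ^ k) ^ j = 0 := by
  have h1 : ω ^ j ≠ 1 := hω.pow_ne_one_of_pos_of_lt hj hjn
  have h := geom_sum_mul (ω ^ j) n
  rw [← pow_mul, mul_comm j, pow_mul, hω.pow_eq_one, one_pow, sub_self] at h
  simpa only [← pow_mul, mul_comm j] using (mul_eq_zero.1 h).resolve_right (sub_ne_zero.2 h1)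

/-- Fourier inversion along an orbit segment. -/
theorem sum_twisted_sum {X : Type*} (f : X → X) {n : ℕ} (hn : 0 < n) (χ : X → ℂ) {ω : ℂ}
    (hω : IsPrimitiveRoot ω n) (x : X) :
    ∑ k ∈ Finset.range n, ∑ j ∈ Finset.range n, (ω ^ k) ^ j * χ (f^[j] x) = n * χ x := by
  rw [Finset.sum_comm]
  simp only [← Finset.sum_mul]
  rw [Finset.sum_eq_single_of_mem 0 (Finset.mem_range.2 hn)]
  · simp
  · intro j hj hj₀
    rw [hω.sum_pow_mul_eq_zero hj₀ (Finset.mem_range.1 hj), zero_mul]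

theorem Ergodic.iterate_mul {X : Type*} [MeasurableSpace X] {f : X → X} {μ : Measure X}
    [IsProbabilityMeasure μ] {p q : ℕ} (hp : p ≠ 0) (hq : q ≠ 0)
    (hep : Ergodic f^[p] μ) (heq : Ergodic f^[q] μ) (hf : MeasurePreserving f μ μ) :
    Ergodic f^[p * q] μ := by
  refine ⟨hf.iterate _, ⟨fun s hs hfs => ?_⟩⟩
  have hn : 0 < p * q := by positivity
  set χ : X → ℂ := s.indicator 1 with hχ_def
  have hχm : Measurable χ := measurable_one.indicator hs
  have hχ (x : X) : χ (f^[p * q] x) = χ x := by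
    have hmem : f^[p * q] x ∈ s ↔ x ∈ s := Set.ext_iff.1 hfs x
    by_cases hx : x ∈ s <;> simp [hχ_def, hmem, hx]
  have hω := Complex.isPrimitiveRoot_exp (p * q) hn.ne'
  set ω := Complex.exp (2 * Real.pi * Complex.I / (p * q : ℕ))
  have hroot (k : ℕ) : (ω ^ k) ^ (p * q) = 1 := by
    rw [← pow_mul, mul_comm, pow_mul, hω.pow_eq_one, one_pow]
  have hconst (k : ℕ) : ∃ c, (fun x => ∑ j ∈ Finset.range (p * q), (ω ^ k) ^ j * χ (f^[j] x))
      =ᵐ[μ] Function.const X c :=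
    ae_eq_const_of_eigenfunction hq hep heq hf
      (Finset.measurable_fun_sum _ fun j _ =>
        (hχm.comp (hf.measurable.iterate j)).const_mul _)
      (hroot k) (mul_twisted_sum_comp hχ (hroot k))
  choose c hc using hconst
  have hall : ∀ᵐ x ∂μ, (p * q : ℕ) * χ x = ∑ k ∈ Finset.range (p * q), c k := by
    filter_upwards [ae_all_iff.2 hc] with x hx
    rw [← sum_twisted_sum f hn χ hω]
    exact Finset.sum_congr rfl fun k _ => hx k
  have hn' : ((p * q : ℕ) : ℂ) ≠ 0 := Nat.cast_ne_zero.2 hn.ne'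
  rw [eventuallyConst_set]
  by_cases hsum : ∑ k ∈ Finset.range (p * q), c k = 0
  · refine .inr (hall.mono fun x hx hxs => hn' ?_)
    simpa [hχ_def, hxs, hsum] using hx
  · refine .inl (hall.mono fun x hx => ?_)
    by_contra hxs
    exact hsum (by simpa [hχ_def, hxs] using hx.symm)

/-- The average of an `f^n`-invariant probability measure over `n` consecutive iterates of `f` is
an `f`-invariant probability measure. -/
theorem InvProb.average {X : Type*} [MeasurableSpace X] {f : X → X} (hf : Measurable f) {n : ℕ}
    (hn : n ≠ 0) {ν : Measure X} (hν : InvProb f^[n] ν) :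
    InvProb f ((n : ℝ≥0∞)⁻¹ • ∑ j ∈ Finset.range n, ν.map f^[j]) := by
  have hprob := hν.1
  have hn' : (n : ℝ≥0∞) ≠ 0 := Nat.cast_ne_zero.2 hn
  refine ⟨⟨?_⟩, ?_⟩
  · have h1 (j : ℕ) : ν.map f^[j] univ = 1 := by
      rw [Measure.map_apply (hf.iterate j) .univ, preimage_univ, measure_univ]
    simp [h1, ENNReal.inv_mul_cancel hn' (ENNReal.natCast_ne_top n)]
  · rw [Measure.map_smul]
    congr 1
    rw [← Measure.mapₗ_apply_of_measurable hf, map_sum]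
    simp only [Measure.mapₗ_apply_of_measurable hf, Measure.map_map hf (hf.iterate _),
      ← Function.iterate_succ']
    have h₁ := Finset.sum_range_succ (fun j => ν.map f^[j]) n
    rw [Finset.sum_range_succ', hν.2, Function.iterate_zero, Measure.map_id] at h₁
    ext s hs
    have h₂ := congrArg (fun m : Measure X => m s) h₁
    simp only [Measure.add_apply] at h₂
    exact (ENNReal.add_left_inj (measure_ne_top ν s)).1 h₂

theorem absolutelyContinuous_average {X : Type*} [MeasurableSpace X] (f : X → X) {n : ℕ}
    (hn : n ≠ 0) (ν : Measure X) :
    ν ≪ (n : ℝ≥0∞)⁻¹ • ∑ j ∈ Finset.range n, ν.map f^[j] := by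
  refine Measure.AbsolutelyContinuous.trans ?_
    (Measure.absolutelyContinuous_smul (ENNReal.inv_ne_zero.2 (ENNReal.natCast_ne_top n)))
  refine Measure.absolutelyContinuous_of_le ?_
  have h := Finset.single_le_sum (f := fun j => ν.map f^[j]) (fun j _ => Measure.zero_le _)
    (Finset.mem_range.2 (Nat.pos_of_ne_zero hn))
  simpa using h

/-- Lemma 2.12: if `(X,μ,f)` is uniquely ergodic and `f^{pq}` is not uniquely ergodic for
primes `p, q`, then `f^p` or `f^q` is not uniquely ergodic. -/
theorem not_uniquelyErgodic_pow_prime_of_mul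
    {X : Type*} [MetricSpace X] [CompactSpace X] [MeasurableSpace X] [BorelSpace X]
    (f : X → X) (hf : IsHomeomorph f) (μ : Measure X) (hue : UniquelyErgodicWith f μ)
    (p q : ℕ) (hp : p.Prime) (hq : q.Prime) (hnue : ¬ UniquelyErgodic (f^[p * q])) :
    ¬ UniquelyErgodic (f^[p]) ∨ ¬ UniquelyErgodic (f^[q]) := by
  by_contra! h
  obtain ⟨hμ, huniq⟩ := hue
  have := hμ.1
  have hfm : Measurable f := hf.continuous.measurable
  have herg (k : ℕ) (hk : UniquelyErgodic f^[k]) : Ergodic f^[k] μ :=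
    (hk.uniquelyErgodicWith (hμ.iterate hfm k)).ergodic (hfm.iterate k)
  have hn : p * q ≠ 0 := mul_ne_zero hp.ne_zero hq.ne_zero
  have hpq : Ergodic f^[p * q] μ :=
    Ergodic.iterate_mul hp.ne_zero hq.ne_zero (herg p h.1) (herg q h.2) ⟨hfm, hμ.2⟩
  refine hnue ⟨μ, hμ.iterate hfm _, fun ν hν => ?_⟩
  have := hν.1
  refine hpq.eq_of_absolutelyContinuous ⟨hfm.iterate _, hν.2⟩ ?_
  rw [← huniq _ (hν.average hfm hn)]
  exact absolutelyContinuous_average f hn ν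
end
end

section
/- Let f be a homeomorphism of the circle 𝕋¹ = {z ∈ ℂ : |z| = 1} such that (𝕋¹,μ,f) is uniquely ergodic and μ is non-atomic. Then for every m ≥ 2 there exists a non-uniform A ∈ C(𝕋¹, GL(m,ℝ)). -/
open MeasureTheory Filter Topology Set
open scoped ENNReal NNReal

attribute [local instance] Matrix.normedAddCommGroup

noncomputable section

instance : MeasurableSpace Circle := borel Circle
instance : BorelSpace Circle := ⟨rfl⟩

/-- The nowhere vanishing map `g` on the circle has winding number `k` about the origin,
witnessed by a continuous logarithm of `g x / x ^ k`. -/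
def HasWinding (g : Circle → ℂ) (k : ℤ) : Prop :=
  ∃ ψ : Circle → ℂ, Continuous ψ ∧ ∀ x, g x = (x : ℂ) ^ k * Complex.exp (ψ x)

theorem exists_zpow_mul_exp_eq_one {k : ℤ} (hk : k ≠ 0) {φ : Circle → ℂ} (hφ : Continuous φ)
    (hre : ∀ x, (φ x).re = 0) : ∃ x : Circle, (x : ℂ) ^ k * Complex.exp (φ x) = 1 := by
  set G : ℝ → ℝ := fun t => k * t + (φ (Circle.exp t)).im with hG
  have hGc : Continuous G := by fun_prop
  have hper : G (2 * Real.pi) = G 0 + k * (2 * Real.pi) := by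
    simp only [hG, Circle.exp_two_pi, Circle.exp_zero]; ring
  have hpi := Real.two_pi_pos
  obtain ⟨j, t, ht⟩ : ∃ (j : ℤ) (t : ℝ), G t = j * (2 * Real.pi) := by
    have key : ∀ a b : ℝ, a + 2 * Real.pi ≤ b →
        ∃ j : ℤ, (j : ℝ) * (2 * Real.pi) ∈ Icc a b := by
      intro a b hab
      refine ⟨⌈a / (2 * Real.pi)⌉, ?_, ?_⟩
      · exact (div_le_iff₀ hpi).1 (Int.le_ceil _)
      · have h1 := (Int.ceil_lt_add_one (a / (2 * Real.pi))).le
        have h2 := mul_le_mul_of_nonneg_right h1 hpi.le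
        rw [add_mul, div_mul_cancel₀ _ hpi.ne'] at h2
        linarith
    rcases lt_or_gt_of_ne hk with h | h
    · have h1 : (k : ℝ) ≤ -1 := by exact_mod_cast Int.le_sub_one_of_lt h
      obtain ⟨j, hj⟩ := key (G (2 * Real.pi)) (G 0) (by nlinarith)
      obtain ⟨t, -, ht⟩ := intermediate_value_Icc' hpi.le hGc.continuousOn hj
      exact ⟨j, t, ht⟩
    · have h1 : (1 : ℝ) ≤ k := by exact_mod_cast h
      obtain ⟨j, hj⟩ := key (G 0) (G (2 * Real.pi)) (by nlinarith)
      obtain ⟨t, -, ht⟩ := intermediate_value_Icc hpi.le hGc.continuousOn hj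
      exact ⟨j, t, ht⟩
  refine ⟨Circle.exp t, ?_⟩
  have h1 : φ (Circle.exp t) = ((φ (Circle.exp t)).im : ℂ) * Complex.I := by
    apply Complex.ext <;> simp [hre]
  rw [h1, Circle.coe_exp, ← Complex.exp_int_mul, ← Complex.exp_add, Complex.exp_eq_one_iff]
  refine ⟨j, ?_⟩
  have h2 : (k : ℂ) * t + ((φ (Circle.exp t)).im : ℂ) = j * (2 * Real.pi) := by
    exact_mod_cast ht
  linear_combination Complex.I * h2

namespace HasWinding

variable {g g₁ g₂ : Circle → ℂ} {k l : ℤ}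

theorem ne_zero (h : HasWinding g k) (x : Circle) : g x ≠ 0 := by
  obtain ⟨ψ, -, h⟩ := h
  rw [h]
  exact mul_ne_zero (zpow_ne_zero _ x.coe_ne_zero) (Complex.exp_ne_zero _)

theorem mul (h₁ : HasWinding g₁ k) (h₂ : HasWinding g₂ l) :
    HasWinding (fun x => g₁ x * g₂ x) (k + l) := by
  obtain ⟨ψ₁, c₁, h₁⟩ := h₁
  obtain ⟨ψ₂, c₂, h₂⟩ := h₂
  refine ⟨fun x => ψ₁ x + ψ₂ x, by fun_prop, fun x => ?_⟩
  beta_reduce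
  rw [h₁, h₂, zpow_add₀ x.coe_ne_zero, Complex.exp_add]
  ring

theorem inv (h : HasWinding g k) : HasWinding (fun x => (g x)⁻¹) (-k) := by
  obtain ⟨ψ, c, h⟩ := h
  refine ⟨fun x => -ψ x, by fun_prop, fun x => ?_⟩
  beta_reduce
  rw [h, mul_inv, zpow_neg, Complex.exp_neg]

theorem conj (h : HasWinding g k) : HasWinding (fun x => starRingEnd ℂ (g x)) (-k) := by
  obtain ⟨ψ, c, h⟩ := h
  refine ⟨fun x => starRingEnd ℂ (ψ x), Complex.continuous_conj.comp c, fun x => ?_⟩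
  beta_reduce
  rw [h, map_mul, map_zpow₀, ← Circle.coe_inv_eq_conj, Circle.coe_inv, inv_zpow, zpow_neg,
    Complex.exp_conj]

theorem of_mul_right (h : HasWinding (fun x => g₁ x * g₂ x) k) (h₂ : HasWinding g₂ l) :
    HasWinding g₁ (k - l) := by
  have h₃ := h.mul h₂.inv
  have : (fun x => g₁ x * g₂ x * (g₂ x)⁻¹) = g₁ := by
    funext x
    rw [mul_assoc, mul_inv_cancel₀ (h₂.ne_zero x), mul_one]
  rwa [this, ← sub_eq_add_neg] at h₃

theorem const {a : ℂ} (ha : a ≠ 0) : HasWinding (fun _ => a) 0 :=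
  ⟨fun _ => Complex.log a, continuous_const, fun x => by simp [Complex.exp_log ha]⟩

theorem coe : HasWinding (fun x => (x : ℂ)) 1 :=
  ⟨fun _ => 0, continuous_const, fun x => by simp⟩

theorem comp {f : Circle → Circle} (hf : Continuous f) (h : HasWinding g k)
    (hfw : HasWinding (fun x => (f x : ℂ)) l) : HasWinding (fun x => g (f x)) (l * k) := by
  obtain ⟨ψ, c, h⟩ := h
  obtain ⟨χ, d, hχ⟩ := hfw
  refine ⟨fun x => k * χ x + ψ (f x), by fun_prop, fun x => ?_⟩
  beta_reduce
  have hx := hχ x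
  beta_reduce at hx
  rw [h, hx, Complex.exp_add, Complex.exp_int_mul, mul_zpow, ← zpow_mul, mul_assoc]

theorem of_norm_sub_lt (h : HasWinding g₁ k) (hc : Continuous g₂) (hc₁ : Continuous g₁)
    (hlt : ∀ x, ‖g₂ x - g₁ x‖ < ‖g₁ x‖) : HasWinding g₂ k := by
  have hne := h.ne_zero
  obtain ⟨ψ, c, h⟩ := h
  have hlt' : ∀ x, ‖g₂ x / g₁ x - 1‖ < 1 := by
    intro x
    rw [div_sub_one (hne x), norm_div, div_lt_one (norm_pos_iff.2 (hne x))]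
    exact hlt x
  have hslit : ∀ x, g₂ x / g₁ x ∈ Complex.slitPlane := by
    intro x
    left
    have := (Complex.abs_re_le_norm (g₂ x / g₁ x - 1)).trans_lt (hlt' x)
    rw [abs_lt, Complex.sub_re, Complex.one_re] at this
    linarith [this.1]
  refine ⟨fun x => ψ x + Complex.log (g₂ x / g₁ x),
    c.add ((hc.div hc₁ hne).clog hslit), fun x => ?_⟩
  rw [Complex.exp_add, Complex.exp_log (Complex.slitPlane_ne_zero (hslit x)), ← mul_assoc, ← h,
    mul_div_cancel₀ _ (hne x)]

theorem unique (h₁ : HasWinding g k) (h₂ : HasWinding g l) : k = l := by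
  by_contra hkl
  have h := h₁.mul h₂.inv
  rw [← sub_eq_add_neg] at h
  obtain ⟨ψ, c, h⟩ := h
  have h' : ∀ x : Circle, (x : ℂ) ^ (k - l) * Complex.exp (ψ x) = 1 := fun x =>
    (h x).symm.trans (mul_inv_cancel₀ (h₁.ne_zero x))
  have hre : ∀ x, (ψ x).re = 0 := by
    intro x
    have := congrArg norm (h' x)
    simpa [Complex.norm_exp, Circle.norm_coe] using this
  obtain ⟨x, hx⟩ := exists_zpow_mul_exp_eq_one (sub_ne_zero.2 hkl)
    (φ := fun x => ψ x + Real.pi * Complex.I) (by fun_prop) (by simpa using hre)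
  rw [Complex.exp_add, Complex.exp_pi_mul_I, ← mul_assoc, h'] at hx
  norm_num at hx

end HasWinding

theorem exists_hasWinding {g : Circle → ℂ} (hg : Continuous g) (h0 : ∀ x, g x ≠ 0) :
    ∃ k, HasWinding g k := by
  obtain ⟨e, ⟨-, he⟩, -⟩ := Complex.isCoveringMapOn_exp.existsUnique_continuousMap_lifts
    (⟨fun t : ℝ => g (Circle.exp t), by fun_prop⟩ : C(ℝ, ℂ)) (a₀ := 0)
    (e₀ := Complex.log (g (Circle.exp 0))) (Complex.exp_log (h0 _)) (fun t => h0 _)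
  have he' : ∀ t, Complex.exp (e t) = g (Circle.exp t) := fun t => congrFun he t
  have hcov := Complex.isCoveringMap_exp
  have hD1 : ∀ t, Complex.exp (e (t + 2 * Real.pi) - e t) = 1 := by
    intro t
    rw [Complex.exp_sub, he', he', Circle.exp_add, Circle.exp_two_pi, mul_one, div_self (h0 _)]
  have hD : ∀ t, e (t + 2 * Real.pi) - e t = e (0 + 2 * Real.pi) - e 0 := fun t =>
    hcov.const_of_comp (g := fun t : ℝ => e (t + 2 * Real.pi) - e t) (by fun_prop)
      (fun a b => Subtype.ext ((hD1 a).trans (hD1 b).symm)) t 0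
  obtain ⟨k, hk⟩ := Complex.exp_eq_one_iff.1 (hD1 0)
  have hq : IsQuotientMap (Circle.exp : ℝ → Circle) :=
    Circle.isAddQuotientCoveringMap_exp.toIsQuotientMap
  have hper : Function.Periodic (fun t : ℝ => e t - k * (t * Complex.I)) (2 * Real.pi) := by
    intro t
    have := hD t
    rw [hk] at this
    push_cast
    linear_combination this
  have hfac : ∀ a b : ℝ, Circle.exp a = Circle.exp b →
      e a - k * (a * Complex.I) = e b - k * (b * Complex.I) := by
    intro a b hab
    obtain ⟨j, hj⟩ := Circle.exp_eq_exp.1 hab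
    rw [hj]
    exact hper.int_mul j b
  refine ⟨k, fun x => e (Complex.arg x) - k * (Complex.arg x * Complex.I), ?_, fun x => ?_⟩
  · rw [hq.continuous_iff]
    have : (fun x : Circle => e (Complex.arg x) - k * (Complex.arg x * Complex.I)) ∘ Circle.exp
        = fun t : ℝ => e t - k * (t * Complex.I) := by
      funext t
      exact hfac _ _ (Circle.exp_arg _)
    rw [this]
    fun_prop
  · rw [Complex.exp_sub, he', Circle.exp_arg, Complex.exp_int_mul, ← Circle.coe_exp,
      Circle.exp_arg, mul_div_cancel₀ _ (zpow_ne_zero _ x.coe_ne_zero)]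

/-- A fixed point free continuous self-map of the circle has degree one. -/
theorem hasWinding_one_of_forall_ne {f : Circle → Circle} (hf : Continuous f)
    (hfix : ∀ x, f x ≠ x) : HasWinding (fun x => (f x : ℂ)) 1 := by
  obtain ⟨d, hd⟩ := exists_hasWinding (g := fun x => (f x : ℂ)) (by fun_prop)
    (fun x => (f x).coe_ne_zero)
  by_cases h1 : d = 1
  · exact h1 ▸ hd
  obtain ⟨ψ, c, h⟩ := hd
  have hre : ∀ x, (ψ x).re = 0 := by
    intro x
    have := congrArg norm (h x)
    simpa [Complex.norm_exp, Circle.norm_coe] using this.symm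
  obtain ⟨x, hx⟩ := exists_zpow_mul_exp_eq_one (sub_ne_zero.2 h1) c hre
  refine absurd (Circle.ext ?_) (hfix x)
  refine (h x).trans ?_
  rw [← sub_add_cancel d 1, zpow_add₀ x.coe_ne_zero, zpow_one, mul_right_comm, hx, one_mul]

section Coefficients

variable {X : Type*} (f : X → X) (u : X → ℂ)

/-- The coefficients `(p, q)` of the real-linear map `v ↦ p * v + q * conj v` of the plane obtained
as the `n`-fold product along the orbit of `x` of the maps
`v ↦ u x * (5 / 4 * v + 3 / 4 * conj v)`. -/
def prodCoeff : ℕ → X → ℂ × ℂ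
  | 0, _ => (1, 0)
  | n + 1, x =>
    (u (f^[n] x) * (5 / 4 * (prodCoeff n x).1 + 3 / 4 * starRingEnd ℂ (prodCoeff n x).2),
      u (f^[n] x) * (5 / 4 * (prodCoeff n x).2 + 3 / 4 * starRingEnd ℂ (prodCoeff n x).1))

theorem prodCoeff_succ_fst (n : ℕ) (x : X) : (prodCoeff f u (n + 1) x).1 =
    u (f^[n] x) * (5 / 4 * (prodCoeff f u n x).1
      + 3 / 4 * starRingEnd ℂ (prodCoeff f u n x).2) := rfl

theorem prodCoeff_succ_snd (n : ℕ) (x : X) : (prodCoeff f u (n + 1) x).2 =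
    u (f^[n] x) * (5 / 4 * (prodCoeff f u n x).2
      + 3 / 4 * starRingEnd ℂ (prodCoeff f u n x).1) := rfl

theorem prodCoeff_succ' (n : ℕ) (x : X) : prodCoeff f u (n + 1) x =
    (5 / 4 * u x * (prodCoeff f u n (f x)).1
        + 3 / 4 * starRingEnd ℂ (u x) * (prodCoeff f u n (f x)).2,
      3 / 4 * u x * (prodCoeff f u n (f x)).1
        + 5 / 4 * starRingEnd ℂ (u x) * (prodCoeff f u n (f x)).2) := by
  induction n with
  | zero => simp [prodCoeff]; ring_nf; trivial
  | succ n ih =>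
    apply Prod.ext
    · rw [prodCoeff_succ_fst, ih, prodCoeff_succ_fst, prodCoeff_succ_snd,
        Function.iterate_succ_apply]
      simp only [map_add, map_mul, map_div₀, Complex.conj_ofNat, Complex.conj_conj]
      ring
    · rw [prodCoeff_succ_snd, ih, prodCoeff_succ_fst, prodCoeff_succ_snd,
        Function.iterate_succ_apply]
      simp only [map_add, map_mul, map_div₀, Complex.conj_ofNat, Complex.conj_conj]
      ring

theorem continuous_prodCoeff [TopologicalSpace X] {f : X → X} {u : X → ℂ} (hf : Continuous f)
    (hu : Continuous u) (n : ℕ) : Continuous (prodCoeff f u n) := by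
  induction n with
  | zero => exact continuous_const
  | succ n ih =>
    have := hf.iterate n
    have hc : Continuous (starRingEnd ℂ) := Complex.continuous_conj
    simp only [prodCoeff]
    fun_prop

theorem norm_combination_bounds {a b : ℂ} (h : ‖b‖ ≤ ‖a‖) :
    ‖a‖ / 2 ≤ ‖5 / 4 * a + 3 / 4 * b‖ ∧ ‖5 / 4 * a + 3 / 4 * b‖ ≤ 2 * ‖a‖ := by
  have ha : ‖5 / 4 * a‖ = 5 / 4 * ‖a‖ := by norm_num [norm_mul]
  have hb : ‖3 / 4 * b‖ = 3 / 4 * ‖b‖ := by norm_num [norm_mul]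
  have h1 := norm_add_le (5 / 4 * a) (3 / 4 * b)
  have h2 := norm_sub_le_norm_add (5 / 4 * a) (3 / 4 * b)
  rw [ha, hb] at h1 h2
  constructor <;> linarith

theorem normSq_combination_sub (a b : ℂ) :
    ‖5 / 4 * a + 3 / 4 * starRingEnd ℂ b‖ ^ 2 - ‖5 / 4 * b + 3 / 4 * starRingEnd ℂ a‖ ^ 2
      = ‖a‖ ^ 2 - ‖b‖ ^ 2 := by
  simp only [Complex.sq_norm, Complex.normSq_apply, Complex.add_re, Complex.add_im, Complex.mul_re,
    Complex.mul_im, Complex.conj_re, Complex.conj_im, Complex.div_ofNat_re, Complex.div_ofNat_im,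
    Complex.re_ofNat, Complex.im_ofNat]
  ring

variable {f u} (hu : ∀ x, ‖u x‖ = 1)
include hu

theorem prodCoeff_norm_sq_sub (n : ℕ) (x : X) :
    ‖(prodCoeff f u n x).1‖ ^ 2 - ‖(prodCoeff f u n x).2‖ ^ 2 = 1 := by
  induction n with
  | zero => simp [prodCoeff]
  | succ n ih =>
    rw [prodCoeff_succ_fst, prodCoeff_succ_snd, norm_mul, norm_mul, hu, one_mul, one_mul,
      normSq_combination_sub, ih]

theorem one_le_norm_prodCoeff (n : ℕ) (x : X) : 1 ≤ ‖(prodCoeff f u n x).1‖ := by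
  nlinarith [prodCoeff_norm_sq_sub hu n x (f := f), norm_nonneg (prodCoeff f u n x).1,
    sq_nonneg ‖(prodCoeff f u n x).2‖]

theorem norm_prodCoeff_snd_le (n : ℕ) (x : X) :
    ‖(prodCoeff f u n x).2‖ ≤ ‖(prodCoeff f u n x).1‖ := by
  nlinarith [prodCoeff_norm_sq_sub hu n x (f := f), one_le_norm_prodCoeff hu n x (f := f),
    norm_nonneg (prodCoeff f u n x).2]

theorem norm_prodCoeff_succ_bounds (n : ℕ) (x : X) :
    ‖(prodCoeff f u n x).1‖ / 2 ≤ ‖(prodCoeff f u (n + 1) x).1‖ ∧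
      ‖(prodCoeff f u (n + 1) x).1‖ ≤ 2 * ‖(prodCoeff f u n x).1‖ := by
  rw [prodCoeff_succ_fst, norm_mul, hu, one_mul]
  apply norm_combination_bounds
  rw [RCLike.norm_conj]
  exact norm_prodCoeff_snd_le hu n x

theorem norm_prodCoeff_succ_bounds' (n : ℕ) (x : X) :
    ‖(prodCoeff f u n (f x)).1‖ / 2 ≤ ‖(prodCoeff f u (n + 1) x).1‖ ∧
      ‖(prodCoeff f u (n + 1) x).1‖ ≤ 2 * ‖(prodCoeff f u n (f x)).1‖ := by
  have h := norm_combination_bounds (a := u x * (prodCoeff f u n (f x)).1)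
    (b := starRingEnd ℂ (u x) * (prodCoeff f u n (f x)).2)
    (by simpa [hu] using norm_prodCoeff_snd_le hu n (f x))
  rw [norm_mul, hu, one_mul, ← mul_assoc, ← mul_assoc] at h
  rw [prodCoeff_succ']
  exact h

theorem norm_prodCoeff_le_two_pow (n : ℕ) (x : X) : ‖(prodCoeff f u n x).1‖ ≤ 2 ^ n := by
  induction n with
  | zero => simp [prodCoeff]
  | succ n ih =>
    have := (norm_prodCoeff_succ_bounds (f := f) hu n x).2
    rw [pow_succ]
    linarith

theorem cross_prodCoeff (n : ℕ) (x : X) :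
    (prodCoeff f u (n + 1) x).2 * (prodCoeff f u n x).1
      - (prodCoeff f u n x).2 * (prodCoeff f u (n + 1) x).1 = 3 / 4 * u (f^[n] x) := by
  have h := prodCoeff_norm_sq_sub (f := f) hu n x
  have h' : (prodCoeff f u n x).1 * starRingEnd ℂ (prodCoeff f u n x).1
      - (prodCoeff f u n x).2 * starRingEnd ℂ (prodCoeff f u n x).2 = 1 := by
    rw [Complex.mul_conj', Complex.mul_conj']
    exact_mod_cast h
  rw [prodCoeff_succ_fst, prodCoeff_succ_snd]
  linear_combination (3 / 4 * u (f^[n] x)) * h'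

theorem cross_prodCoeff' (n : ℕ) (x : X) :
    (prodCoeff f u (n + 1) x).2 * starRingEnd ℂ (prodCoeff f u n (f x)).1
      - (prodCoeff f u n (f x)).2 * starRingEnd ℂ (prodCoeff f u (n + 1) x).1
      = 3 / 4 * u x := by
  have h := prodCoeff_norm_sq_sub (f := f) hu n (f x)
  have h' : (prodCoeff f u n (f x)).1 * starRingEnd ℂ (prodCoeff f u n (f x)).1
      - (prodCoeff f u n (f x)).2 * starRingEnd ℂ (prodCoeff f u n (f x)).2 = 1 := by
    rw [Complex.mul_conj', Complex.mul_conj']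
    exact_mod_cast h
  rw [prodCoeff_succ']
  simp only [map_add, map_mul, map_div₀, Complex.conj_ofNat, Complex.conj_conj]
  linear_combination (3 / 4 * u x) * h'

end Coefficients

theorem hasWinding_comp_iterate {f : Circle → Circle} (hf : Continuous f)
    (hfw : HasWinding (fun x => (f x : ℂ)) 1) {g : Circle → ℂ} {k : ℤ} (hg : HasWinding g k)
    (n : ℕ) : HasWinding (fun x => g (f^[n] x)) k := by
  induction n with
  | zero => exact hg
  | succ n ih => simpa [Function.iterate_succ_apply] using ih.comp hf hfw

/-- The products of a cocycle that winds around the circle cannot all be large. -/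
theorem exists_norm_prodCoeff_le {f : Circle → Circle} (hf : Continuous f)
    (hfw : HasWinding (fun x => (f x : ℂ)) 1) {u : Circle → ℂ} (huc : Continuous u)
    (hu : ∀ x, ‖u x‖ = 1) (huw : HasWinding u 1) (n : ℕ) :
    ∃ x, ‖(prodCoeff f u n x).1‖ ≤ 4 := by
  by_contra! hbig
  have hpc := (continuous_prodCoeff hf huc n).fst
  have hqc := (continuous_prodCoeff hf huc n).snd
  have hpc' := (continuous_prodCoeff hf huc (n + 1)).fst
  have hqc' := (continuous_prodCoeff hf huc (n + 1)).snd
  have hconj : Continuous (starRingEnd ℂ) := Complex.continuous_conj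
  have hq : ∀ x, 3 < ‖(prodCoeff f u n x).2‖ := fun x => by
    nlinarith [prodCoeff_norm_sq_sub (f := f) hu n x, hbig x, norm_nonneg (prodCoeff f u n x).2]
  have hp' : ∀ x, 2 < ‖(prodCoeff f u (n + 1) x).1‖ := fun x => by
    linarith [hbig x, (norm_prodCoeff_succ_bounds (f := f) hu n x).1]
  have h34 : ∀ z : ℂ, ‖z‖ = 1 → ‖3 / 4 * z‖ < 1 := fun z hz => by
    rw [norm_mul, hz]
    norm_num
  obtain ⟨k, hk⟩ := exists_hasWinding hpc
    (fun x => norm_pos_iff.1 (by linarith [hbig x]))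
  obtain ⟨l, hl⟩ := exists_hasWinding hqc
    (fun x => norm_pos_iff.1 (by linarith [hq x]))
  have hk' : HasWinding (fun x => (prodCoeff f u (n + 1) x).1) (k + 1) := by
    have h1 := (hasWinding_comp_iterate hf hfw huw n).mul
      ((HasWinding.const (a := 5 / 4) (by norm_num)).mul hk)
    rw [zero_add, add_comm] at h1
    have hfn := hf.iterate n
    refine h1.of_norm_sub_lt hpc' (by fun_prop) fun x => ?_
    rw [prodCoeff_succ_fst, ← mul_sub, add_sub_cancel_left, norm_mul, norm_mul, norm_mul, norm_mul,
      RCLike.norm_conj]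
    have h2 := norm_prodCoeff_snd_le (f := f) hu n x
    have h3 := hbig x
    rw [hu]
    norm_num
    linarith
  have key₁ := ((hl.mul hk').of_norm_sub_lt
    (g₂ := fun x => (prodCoeff f u (n + 1) x).2 * (prodCoeff f u n x).1)
    (hqc'.mul hpc) (hqc.mul hpc') fun x => by
    rw [cross_prodCoeff hu, norm_mul (prodCoeff f u n x).2]
    nlinarith [h34 (u (f^[n] x)) (hu _), hq x, hp' x]).of_mul_right hk
  have hlf := hl.comp hf hfw
  have hkf := (hk.comp hf hfw).conj
  have key₂ := ((hlf.mul hk'.conj).of_norm_sub_lt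
    (g₂ := fun x => (prodCoeff f u (n + 1) x).2 * starRingEnd ℂ (prodCoeff f u n (f x)).1)
    (hqc'.mul (hconj.comp (hpc.comp hf))) ((hqc.comp hf).mul (hconj.comp hpc')) fun x => by
    rw [cross_prodCoeff' hu, norm_mul (prodCoeff f u n (f x)).2, RCLike.norm_conj]
    nlinarith [h34 (u x) (hu _), hq (f x), hp' x]).of_mul_right hkf
  have := key₁.unique key₂
  lia

/-- The empirical measure of the first `n + 1` points of the orbit of `z`. -/
def empiricalMeasure {X : Type*} [MeasurableSpace X] (f : X → X) (z : X) (n : ℕ) :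
    ProbabilityMeasure X :=
  ⟨((n : ℝ≥0∞) + 1)⁻¹ • ∑ k ∈ Finset.range (n + 1), Measure.dirac (f^[k] z), ⟨by
    simp only [Measure.smul_apply, Measure.finsetSum_apply, measure_univ, Finset.sum_const,
      Finset.card_range, smul_eq_mul, nsmul_eq_mul, mul_one, Nat.cast_add, Nat.cast_one]
    exact ENNReal.inv_mul_cancel (by simp) (by finiteness)⟩⟩

theorem integral_empiricalMeasure {X : Type*} [MeasurableSpace X] [TopologicalSpace X]
    [BorelSpace X] (f : X → X) (z : X) (n : ℕ) {φ : X → ℝ} (hφ : Continuous φ) :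
    ∫ x, φ x ∂(empiricalMeasure f z n : Measure X) = birkhoffAverage ℝ f φ (n + 1) z := by
  have hm := hφ.stronglyMeasurable
  rw [empiricalMeasure, ProbabilityMeasure.coe_mk, integral_smul_measure,
    integral_finsetSum_measure fun k _ => integrable_dirac' hm (by simp)]
  simp only [integral_dirac' _ _ hm, birkhoffAverage, birkhoffSum]
  congr 1
  rw [ENNReal.toReal_inv, ENNReal.toReal_add (by finiteness) (by finiteness)]
  simp

theorem exists_invProb_integral_eq {X : Type*} [MeasurableSpace X] [TopologicalSpace X]
    [T2Space X] [CompactSpace X] [BorelSpace X] [HasOuterApproxClosed X] {f : X → X}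
    (hf : Continuous f) (z : X) :
    ∃ ν : Measure X, InvProb f ν ∧
      ∀ g : X → ℝ, Continuous g → (∀ x, g (f x) = g x) → ∫ x, g x ∂ν = g z := by
  let F : Ultrafilter (ProbabilityMeasure X) := (hyperfilter ℕ).map (empiricalMeasure f z)
  obtain ⟨ν, -, hν⟩ := isCompact_univ.ultrafilter_le_nhds F (by simp)
  have hν' : Tendsto (empiricalMeasure f z) (hyperfilter ℕ) (𝓝 ν) := hν
  rw [ProbabilityMeasure.tendsto_iff_forall_integral_tendsto] at hν'
  have hlim : ∀ φ : X → ℝ, Continuous φ →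
      Tendsto (fun n => birkhoffAverage ℝ f φ (n + 1) z) (hyperfilter ℕ)
        (𝓝 (∫ x, φ x ∂(ν : Measure X))) := by
    intro φ hφ
    have := hν' (BoundedContinuousFunction.mkOfCompact ⟨φ, hφ⟩)
    simpa [integral_empiricalMeasure, hφ] using this
  have hat : (hyperfilter ℕ : Filter ℕ) ≤ atTop := Nat.cofinite_eq_atTop ▸ hyperfilter_le_cofinite
  refine ⟨ν, ⟨inferInstance, ?_⟩, fun g hg hinv => ?_⟩
  · have : IsFiniteMeasure ((ν : Measure X).map f) :=
      (ν : Measure X).isFiniteMeasure_map f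
    refine ext_of_forall_integral_eq_of_IsFiniteMeasure fun φ => ?_
    rw [integral_map hf.aemeasurable φ.continuous.aestronglyMeasurable]
    have h1 := (hlim (fun x => φ (f x)) (φ.continuous.comp hf)).sub (hlim φ φ.continuous)
    have h2 := ((tendsto_birkhoffAverage_apply_sub_birkhoffAverage' ℝ φ.isBounded_range
      (f := f) z).comp (tendsto_add_atTop_nat 1)).mono_left hat
    refine sub_eq_zero.1 (tendsto_nhds_unique h1 (h2.congr fun n => ?_))
    simp only [birkhoffAverage, birkhoffSum, Function.comp_apply, ← Function.iterate_succ_apply,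
      ← Function.iterate_succ_apply']
  · refine tendsto_nhds_unique (hlim g hg) ((tendsto_const_nhds (x := g z)).congr fun n => ?_)
    rw [birkhoffAverage_of_comp_eq ℝ (funext hinv) (by positivity)]

/-- A continuous invariant function on a uniquely ergodic compact system is constant. -/
theorem UniquelyErgodicWith.apply_eq {X : Type*} [MeasurableSpace X] [TopologicalSpace X]
    [T2Space X] [CompactSpace X] [BorelSpace X] [HasOuterApproxClosed X] {f : X → X}
    {μ : Measure X} (h : UniquelyErgodicWith f μ) (hf : Continuous f) {g : X → ℝ}
    (hg : Continuous g) (hinv : ∀ x, g (f x) = g x) (x y : X) : g x = g y := by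
  obtain ⟨ν₁, h₁, hν₁⟩ := exists_invProb_integral_eq hf x
  obtain ⟨ν₂, h₂, hν₂⟩ := exists_invProb_integral_eq hf y
  rw [← hν₁ g hg hinv, ← hν₂ g hg hinv, h.2 ν₁ h₁, h.2 ν₂ h₂]

theorem UniquelyErgodicWith.apply_ne {X : Type*} [MeasurableSpace X] {f : X → X} {μ : Measure X}
    (h : UniquelyErgodicWith f μ) (hf : Measurable f) (hna : ∀ z : X, μ {z} = 0) (x : X) :
    f x ≠ x := by
  intro hx
  have := h.2 (Measure.dirac x) ⟨inferInstance, by rw [Measure.map_dirac' hf, hx]⟩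
  have h1 : (1 : ℝ≥0∞) ≤ Measure.dirac x {x} := by simp
  rw [this, hna] at h1
  simp at h1

/-- If the growth rate of the products converges uniformly, then its limit is zero. -/
theorem tendsto_log_norm_prodCoeff_zero {f : Circle → Circle} (hf : Continuous f)
    {μ : Measure Circle} (hue : UniquelyErgodicWith f μ)
    (hfw : HasWinding (fun x => (f x : ℂ)) 1) {u : Circle → ℂ} (huc : Continuous u)
    (hu : ∀ x, ‖u x‖ = 1) (huw : HasWinding u 1) {L : Circle → ℝ}
    (hL : TendstoUniformly (fun (n : ℕ) x => Real.log ‖(prodCoeff f u n x).1‖ / n) L atTop)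
    (x : Circle) :
    Tendsto (fun n : ℕ => Real.log ‖(prodCoeff f u n x).1‖ / n) atTop (𝓝 0) := by
  have hpos : ∀ n x, 0 < ‖(prodCoeff f u n x).1‖ := fun n x =>
    one_pos.trans_le (one_le_norm_prodCoeff hu n x)
  have hLc : Continuous L := by
    refine hL.continuous (Frequently.of_forall fun n => ?_)
    exact ((continuous_prodCoeff hf huc n).fst.norm.log fun x => (hpos n x).ne').div_const _
  have hinv : ∀ x, L (f x) = L x := by
    intro x
    have h1 := (hL.tendsto_at x).comp (tendsto_add_atTop_nat 1)
    have h2 := hL.tendsto_at (f x)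
    have h3 : Tendsto (fun n : ℕ => ((n : ℝ) + 1) / n) atTop (𝓝 1) := by
      simpa [add_comm] using tendsto_add_mul_div_add_mul_atTop_nhds (1 : ℝ) 0 1 one_ne_zero
    have h4 := h1.mul h3
    have h5 : Tendsto (fun n : ℕ => Real.log 2 / (n : ℝ)) atTop (𝓝 0) :=
      tendsto_const_div_atTop_nhds_zero_nat _
    have h6 := h4.sub h2
    rw [mul_one] at h6
    have h7 : Tendsto (fun n : ℕ => Real.log ‖(prodCoeff f u (n + 1) x).1‖ / ((n + 1 : ℕ) : ℝ)
        * (((n : ℝ) + 1) / n) - Real.log ‖(prodCoeff f u n (f x)).1‖ / n) atTop (𝓝 0) := by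
      refine squeeze_zero_norm (fun n => ?_) h5
      rw [Nat.cast_add, Nat.cast_one, div_mul_div_cancel₀ (by positivity), ← sub_div, norm_div,
        Real.norm_natCast, Real.norm_eq_abs, ← Real.log_div (hpos _ _).ne' (hpos _ _).ne']
      gcongr
      obtain ⟨h8, h9⟩ := norm_prodCoeff_succ_bounds' (f := f) hu n x
      have hp := hpos n (f x)
      rw [abs_le, ← Real.log_inv]
      constructor <;> apply Real.log_le_log (by have := hpos (n + 1) x; positivity)
      · rw [le_div_iff₀ hp]; linarith
      · rw [div_le_iff₀ hp]; linarith
    linarith [tendsto_nhds_unique h6 h7]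
  have hL0 : ∀ ε > 0, L x < ε := by
    intro ε hε
    have h1 := Metric.tendstoUniformly_iff.1 hL (ε / 2) (by positivity)
    have h2 : ∀ᶠ n : ℕ in atTop, Real.log 4 / (n : ℝ) < ε / 2 :=
      (tendsto_const_div_atTop_nhds_zero_nat _).eventually_lt_const (by positivity)
    obtain ⟨n, hn1, hn2⟩ := (h1.and h2).exists
    obtain ⟨z, hz⟩ := exists_norm_prodCoeff_le hf hfw huc hu huw n
    have h3 := hn1 z
    have h4 : Real.log ‖(prodCoeff f u n z).1‖ / n ≤ Real.log 4 / n := by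
      gcongr
      exact hpos n z
    rw [Real.dist_eq, abs_lt] at h3
    rw [hue.apply_eq hf hLc hinv x z]
    linarith [h3.2]
  have hL1 : 0 ≤ L x := ge_of_tendsto' (hL.tendsto_at x) fun n =>
    div_nonneg (Real.log_nonneg (one_le_norm_prodCoeff hu n x)) n.cast_nonneg
  have hLx : L x = 0 := le_antisymm (le_of_forall_pos_lt_add fun ε hε => by
    simpa using hL0 ε hε) hL1
  exact hLx ▸ hL.tendsto_at x

section Average

variable {X : Type*} (f : X → X) (w : X → ℂ)

/-- The pair `(v ^ n * p, v ^ n * conj q)`, for `(p, q)` the coefficients of the cocycle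
`conj v * w`, as a polynomial expression in `v`. -/
def polyCoeff (x : X) : ℕ → ℂ → ℂ × ℂ
  | 0, _ => (1, 0)
  | n + 1, v =>
    (w (f^[n] x) * (5 / 4 * (polyCoeff x n v).1 + 3 / 4 * (polyCoeff x n v).2),
      v ^ 2 * starRingEnd ℂ (w (f^[n] x)) *
        (5 / 4 * (polyCoeff x n v).2 + 3 / 4 * (polyCoeff x n v).1))

theorem differentiable_polyCoeff (x : X) (n : ℕ) :
    Differentiable ℂ (fun v => (polyCoeff f w x n v).1) ∧
      Differentiable ℂ (fun v => (polyCoeff f w x n v).2) := by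
  induction n with
  | zero => exact ⟨differentiable_const _, differentiable_const _⟩
  | succ n ih =>
    obtain ⟨h1, h2⟩ := ih
    constructor <;> simp only [polyCoeff] <;> fun_prop

theorem polyCoeff_eq_prodCoeff (x : X) (n : ℕ) {v : ℂ} (hv : ‖v‖ = 1) :
    polyCoeff f w x n v = (v ^ n * (prodCoeff f (fun y => starRingEnd ℂ v * w y) n x).1,
      v ^ n * starRingEnd ℂ (prodCoeff f (fun y => starRingEnd ℂ v * w y) n x).2) := by
  have hvv : v * starRingEnd ℂ v = 1 := by rw [Complex.mul_conj', hv]; simp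
  induction n with
  | zero => simp [polyCoeff, prodCoeff]
  | succ n ih =>
    simp only [polyCoeff, ih, prodCoeff, map_mul, map_add, Complex.conj_conj, map_div₀,
      Complex.conj_ofNat]
    refine Prod.ext ?_ ?_
    · simp only
      linear_combination (- v ^ n * w (f^[n] x) * (5 / 4 *
        (prodCoeff f (fun y => starRingEnd ℂ v * w y) n x).1 + 3 / 4 * starRingEnd ℂ
        (prodCoeff f (fun y => starRingEnd ℂ v * w y) n x).2)) * hvv
    · simp only
      ring

variable {w} (hw : ∀ x, ‖w x‖ = 1)
include hw

theorem polyCoeff_bounds (x : X) (n : ℕ) {v : ℂ} (hv : ‖v‖ ≤ 1) :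
    0 < ‖(polyCoeff f w x n v).1‖ ∧ ‖(polyCoeff f w x n v).2‖ ≤ ‖(polyCoeff f w x n v).1‖ := by
  induction n with
  | zero => simp [polyCoeff]
  | succ n ih =>
    obtain ⟨h1, h2⟩ := ih
    simp only [polyCoeff]
    set a := (polyCoeff f w x n v).1
    set b := (polyCoeff f w x n v).2
    have h3 := (norm_combination_bounds h2).1
    have h4 := normSq_combination_sub a (starRingEnd ℂ b)
    rw [Complex.conj_conj, ← RCLike.norm_conj (5 / 4 * starRingEnd ℂ b + _), map_add, map_mul,
      map_mul, Complex.conj_conj, Complex.conj_conj, RCLike.norm_conj b, map_div₀, map_div₀,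
      Complex.conj_ofNat, Complex.conj_ofNat, Complex.conj_ofNat] at h4
    rw [norm_mul, norm_mul, norm_mul, RCLike.norm_conj, hw, one_mul, mul_one, norm_pow]
    refine ⟨by linarith, ?_⟩
    have h5 : ‖5 / 4 * b + 3 / 4 * a‖ ≤ ‖5 / 4 * a + 3 / 4 * b‖ := by
      refine le_of_sq_le_sq ?_ (norm_nonneg _)
      nlinarith [norm_nonneg b]
    calc ‖v‖ ^ 2 * ‖5 / 4 * b + 3 / 4 * a‖ ≤ 1 * ‖5 / 4 * b + 3 / 4 * a‖ := by
          gcongr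
          exact pow_le_one₀ (norm_nonneg _) hv
      _ ≤ _ := by rwa [one_mul]

theorem norm_polyCoeff_zero (x : X) (n : ℕ) :
    ‖(polyCoeff f w x n 0).1‖ = (5 / 4) ^ n := by
  have h2 : ∀ n, (polyCoeff f w x n 0).2 = 0 := fun n => by cases n <;> simp [polyCoeff]
  induction n with
  | zero => simp [polyCoeff]
  | succ n ih =>
    simp only [polyCoeff, h2, mul_zero, add_zero, norm_mul, hw, ih, pow_succ]
    norm_num
    ring

theorem circleAverage_log_norm_polyCoeff (x : X) (n : ℕ) :
    Real.circleAverage (fun v => Real.log ‖(polyCoeff f w x n v).1‖) 0 1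
      = n * Real.log (5 / 4) := by
  rw [AnalyticOnNhd.circleAverage_log_norm_of_ne_zero (fun v _ =>
      (differentiable_polyCoeff f w x n).1.analyticAt v) fun v hv => ?_,
    norm_polyCoeff_zero f hw, Real.log_pow]
  rw [abs_one, mem_closedBall_zero_iff] at hv
  exact norm_pos_iff.1 (polyCoeff_bounds f hw x n hv).1

/-- For some rotation of the cocycle the growth rate along the orbit of `x` is not zero. -/
theorem exists_not_tendsto_log_norm_prodCoeff (x : X) :
    ∃ v : ℂ, ‖v‖ = 1 ∧ ¬ Tendsto (fun n : ℕ =>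
      Real.log ‖(prodCoeff f (fun y => starRingEnd ℂ v * w y) n x).1‖ / n) atTop (𝓝 0) := by
  by_contra! hcon
  have hcm : ∀ θ, ‖circleMap 0 1 θ‖ = 1 := fun θ => by simp
  have hnorm : ∀ n θ, ‖(polyCoeff f w x n (circleMap 0 1 θ)).1‖
      = ‖(prodCoeff f (fun y => starRingEnd ℂ (circleMap 0 1 θ) * w y) n x).1‖ := by
    intro n θ
    rw [polyCoeff_eq_prodCoeff f w x n (hcm θ), norm_mul, norm_pow, hcm, one_pow, one_mul]
  have hu : ∀ θ y, ‖starRingEnd ℂ (circleMap 0 1 θ) * w y‖ = 1 := fun θ y => by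
    rw [norm_mul, RCLike.norm_conj, hcm, hw, one_mul]
  have hpos : ∀ n θ, 0 < ‖(polyCoeff f w x n (circleMap 0 1 θ)).1‖ := fun n θ =>
    (polyCoeff_bounds f hw x n (hcm θ).le).1
  have key := intervalIntegral.tendsto_integral_filter_of_dominated_convergence (l := atTop)
    (F := fun (n : ℕ) θ => Real.log ‖(polyCoeff f w x n (circleMap 0 1 θ)).1‖ / n)
    (f := fun _ => 0) (a := 0) (b := 2 * Real.pi) (μ := volume) (fun _ => Real.log 2)
    (Eventually.of_forall fun n => by
      have h1 := (differentiable_polyCoeff f w x n).1.continuous.comp (continuous_circleMap 0 1)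
      exact ((h1.norm.log fun θ => (hpos n θ).ne').div_const _).aestronglyMeasurable)
    (Eventually.of_forall fun n => Eventually.of_forall fun θ _ => by
      rw [hnorm, norm_div, Real.norm_natCast,
        Real.norm_of_nonneg (Real.log_nonneg (one_le_norm_prodCoeff (hu θ) n x))]
      refine div_le_of_le_mul₀ n.cast_nonneg (Real.log_nonneg one_le_two) ?_
      rw [mul_comm, ← Real.log_pow]
      refine Real.log_le_log (hnorm n θ ▸ hpos n θ) (norm_prodCoeff_le_two_pow (hu θ) n x))
    intervalIntegrable_const
    (Eventually.of_forall fun θ _ => by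
      simp only [hnorm]
      exact hcon _ (hcm θ))
  have hconst : ∀ᶠ n : ℕ in atTop,
      (∫ θ in (0 : ℝ)..2 * Real.pi, Real.log ‖(polyCoeff f w x n (circleMap 0 1 θ)).1‖ / n)
        = 2 * Real.pi * Real.log (5 / 4) := by
    filter_upwards [eventually_gt_atTop 0] with n hn
    have h1 := circleAverage_log_norm_polyCoeff f hw x n
    rw [Real.circleAverage_def, smul_eq_mul, inv_mul_eq_iff_eq_mul₀ Real.two_pi_pos.ne'] at h1
    have hn' : (n : ℝ) ≠ 0 := by positivity
    rw [intervalIntegral.integral_div, h1]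
    field_simp
  have h2 := tendsto_nhds_unique (key.congr' hconst) tendsto_const_nhds
  have h3 : 0 < Real.log (5 / 4) := Real.log_pos (by norm_num)
  rw [intervalIntegral.integral_zero] at h2
  have := Real.two_pi_pos
  nlinarith [mul_pos this h3]

end Average

section RealMatrix

/-- The matrix of the real-linear map `v ↦ p * v + q * conj v` of the plane in the basis `1, I`. -/
def planeMatrix (p q : ℂ) : Matrix (Fin 2) (Fin 2) ℝ :=
  !![p.re + q.re, q.im - p.im; p.im + q.im, p.re - q.re]

theorem planeMatrix_mul (p q p' q' : ℂ) : planeMatrix p q * planeMatrix p' q' =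
    planeMatrix (p * p' + q * starRingEnd ℂ q') (p * q' + q * starRingEnd ℂ p') := by
  ext i j
  fin_cases i <;> fin_cases j <;> simp [planeMatrix, Matrix.mul_apply] <;> ring

theorem planeMatrix_one : planeMatrix 1 0 = 1 := by
  ext i j
  fin_cases i <;> fin_cases j <;> simp [planeMatrix]

theorem det_planeMatrix (p q : ℂ) : (planeMatrix p q).det = ‖p‖ ^ 2 - ‖q‖ ^ 2 := by
  simp only [planeMatrix, Matrix.det_fin_two_of, Complex.sq_norm, Complex.normSq_apply]
  ring

theorem norm_le_norm_planeMatrix (p q : ℂ) : ‖p‖ ≤ 2 * ‖planeMatrix p q‖ := by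
  have h00 := Matrix.norm_entry_le_entrywise_sup_norm (planeMatrix p q) (i := 0) (j := 0)
  have h01 := Matrix.norm_entry_le_entrywise_sup_norm (planeMatrix p q) (i := 0) (j := 1)
  have h10 := Matrix.norm_entry_le_entrywise_sup_norm (planeMatrix p q) (i := 1) (j := 0)
  have h11 := Matrix.norm_entry_le_entrywise_sup_norm (planeMatrix p q) (i := 1) (j := 1)
  simp only [planeMatrix, Matrix.of_apply, Matrix.cons_val_zero, Matrix.cons_val_one,
    Matrix.cons_val_fin_one, Real.norm_eq_abs, abs_le] at h00 h01 h10 h11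
  have h1 : |p.re| ≤ ‖planeMatrix p q‖ := by
    simp only [planeMatrix, abs_le]; constructor <;> linarith
  have h2 : |p.im| ≤ ‖planeMatrix p q‖ := by
    simp only [planeMatrix, abs_le]; constructor <;> linarith
  linarith [Complex.norm_le_abs_re_add_abs_im p]

theorem norm_planeMatrix_le {p q : ℂ} (h : ‖q‖ ≤ ‖p‖) : ‖planeMatrix p q‖ ≤ 2 * ‖p‖ := by
  have h1 := abs_le.1 (Complex.abs_re_le_norm p)
  have h2 := abs_le.1 (Complex.abs_im_le_norm p)
  have h3 := abs_le.1 (Complex.abs_re_le_norm q)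
  have h4 := abs_le.1 (Complex.abs_im_le_norm q)
  rw [Matrix.norm_le_iff (by positivity)]
  intro i j
  fin_cases i <;> fin_cases j <;> simp [planeMatrix, abs_le] <;> constructor <;> linarith

/-- The block-diagonal embedding of `2 × 2` matrices into `(2 + k) × (2 + k)` matrices. -/
def blockEmbed (k : ℕ) (B : Matrix (Fin 2) (Fin 2) ℝ) : Matrix (Fin (2 + k)) (Fin (2 + k)) ℝ :=
  (Matrix.fromBlocks B 0 0 1).submatrix finSumFinEquiv.symm finSumFinEquiv.symm

theorem blockEmbed_mul (k : ℕ) (B C : Matrix (Fin 2) (Fin 2) ℝ) :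
    blockEmbed k (B * C) = blockEmbed k B * blockEmbed k C := by
  simp only [blockEmbed, Matrix.submatrix_mul_equiv, Matrix.fromBlocks_multiply]
  simp

theorem blockEmbed_one (k : ℕ) : blockEmbed k 1 = 1 := by
  simp [blockEmbed, Matrix.fromBlocks_one]

theorem det_blockEmbed (k : ℕ) (B : Matrix (Fin 2) (Fin 2) ℝ) :
    (blockEmbed k B).det = B.det := by
  simp [blockEmbed, Matrix.det_submatrix_equiv_self]

theorem continuous_blockEmbed (k : ℕ) : Continuous (blockEmbed k) :=
  (continuous_id.matrix_fromBlocks continuous_const continuous_const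
    continuous_const).matrix_submatrix _ _

theorem norm_le_norm_blockEmbed (k : ℕ) (B : Matrix (Fin 2) (Fin 2) ℝ) :
    ‖B‖ ≤ ‖blockEmbed k B‖ := by
  rw [Matrix.norm_le_iff (norm_nonneg _)]
  intro i j
  have := Matrix.norm_entry_le_entrywise_sup_norm (blockEmbed k B)
    (i := finSumFinEquiv (Sum.inl i)) (j := finSumFinEquiv (Sum.inl j))
  simpa only [blockEmbed, Matrix.submatrix_apply, Equiv.symm_apply_apply,
    Matrix.fromBlocks_apply₁₁] using this

theorem norm_blockEmbed_le (k : ℕ) (B : Matrix (Fin 2) (Fin 2) ℝ) {r : ℝ} (hr : 1 ≤ r)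
    (hB : ‖B‖ ≤ r) : ‖blockEmbed k B‖ ≤ r := by
  have hr0 : 0 ≤ r := zero_le_one.trans hr
  rw [Matrix.norm_le_iff hr0]
  intro i j
  simp only [blockEmbed, Matrix.submatrix_apply]
  rcases finSumFinEquiv.symm i with i | i <;> rcases finSumFinEquiv.symm j with j | j
  · exact (Matrix.norm_entry_le_entrywise_sup_norm B).trans hB
  · simpa
  · simpa
  · rw [Matrix.fromBlocks_apply₂₂, Matrix.one_apply]
    split_ifs <;> simpa

variable {X : Type*} (k : ℕ) (u : X → ℂ)

/-- The real matrix cocycle whose products are described by `prodCoeff`. -/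
def hyperbolicMatrix (x : X) : Matrix (Fin (2 + k)) (Fin (2 + k)) ℝ :=
  blockEmbed k (planeMatrix (u x * (5 / 4)) (u x * (3 / 4)))

theorem cocycle_hyperbolicMatrix (f : X → X) (n : ℕ) (x : X) :
    cocycle f (hyperbolicMatrix k u) n x
      = blockEmbed k (planeMatrix (prodCoeff f u n x).1 (prodCoeff f u n x).2) := by
  induction n with
  | zero => simp only [cocycle, prodCoeff, planeMatrix_one, blockEmbed_one]
  | succ n ih =>
    rw [cocycle, ih, hyperbolicMatrix, ← blockEmbed_mul, planeMatrix_mul, prodCoeff_succ_fst,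
      prodCoeff_succ_snd]
    congr 2 <;> ring

variable {u}

theorem contGL_hyperbolicMatrix [TopologicalSpace X] (huc : Continuous u)
    (hu : ∀ x, ‖u x‖ = 1) : ContGL (hyperbolicMatrix k u) := by
  refine ⟨(continuous_blockEmbed k).comp ?_, fun x => ?_⟩
  · refine continuous_matrix fun i j => ?_
    fin_cases i <;> fin_cases j <;> simp [planeMatrix] <;> fun_prop
  · rw [Matrix.isUnit_iff_isUnit_det, hyperbolicMatrix, det_blockEmbed, det_planeMatrix,
      norm_mul, norm_mul, hu]
    norm_num

theorem abs_log_norm_cocycle_sub_le (f : X → X) (hu : ∀ x, ‖u x‖ = 1) (n : ℕ) (x : X) :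
    |Real.log ‖cocycle f (hyperbolicMatrix k u) n x‖ - Real.log ‖(prodCoeff f u n x).1‖|
      ≤ Real.log 2 := by
  rw [cocycle_hyperbolicMatrix]
  set p := (prodCoeff f u n x).1
  set q := (prodCoeff f u n x).2
  have hp : 1 ≤ ‖p‖ := one_le_norm_prodCoeff hu n x
  have hp0 : 0 < ‖p‖ := one_pos.trans_le hp
  have h1 := (norm_le_norm_planeMatrix p q).trans
    (mul_le_mul_of_nonneg_left (norm_le_norm_blockEmbed k _) zero_le_two)
  have h2 := norm_blockEmbed_le k _ (by linarith)
    (norm_planeMatrix_le (norm_prodCoeff_snd_le hu n x))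
  set a := ‖blockEmbed k (planeMatrix p q)‖
  have ha0 : 0 < a := by linarith
  rw [abs_le, ← Real.log_div ha0.ne' hp0.ne', ← Real.log_inv]
  constructor <;> apply Real.log_le_log (by positivity)
  · rw [le_div_iff₀ hp0]; linarith
  · rw [div_le_iff₀ hp0]; exact h2

theorem tendstoUniformly_log_norm_prodCoeff {f : X → X} (hu : ∀ x, ‖u x‖ = 1) {L : X → ℝ}
    (hL : TendstoUniformly (fun (n : ℕ) x =>
      Real.log ‖cocycle f (hyperbolicMatrix k u) n x‖ / n) L atTop) :
    TendstoUniformly (fun (n : ℕ) x => Real.log ‖(prodCoeff f u n x).1‖ / n) L atTop := by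
  rw [Metric.tendstoUniformly_iff] at hL ⊢
  intro ε hε
  have h2 : ∀ᶠ n : ℕ in atTop, Real.log 2 / (n : ℝ) < ε / 2 :=
    (tendsto_const_div_atTop_nhds_zero_nat _).eventually_lt_const (by positivity)
  filter_upwards [hL (ε / 2) (by positivity), h2] with n h3 h4 x
  refine (dist_triangle _ _ _).trans_lt ((add_lt_add_of_lt_of_le (h3 x) ?_).trans_eq
    (add_halves ε))
  rw [Real.dist_eq, ← sub_div, abs_div, Nat.abs_cast]
  refine (div_le_div_of_nonneg_right (abs_log_norm_cocycle_sub_le k f hu n x)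
    n.cast_nonneg).trans h4.le

end RealMatrix

/-- Proposition 2.5: a uniquely ergodic homeomorphism of the circle whose unique invariant
measure is non-atomic admits a non-uniform continuous `GL(m,ℝ)`-cocycle for every `m ≥ 2`. -/
theorem exists_nonuniform_cocycle_circle
    (f : Circle → Circle) (hf : IsHomeomorph f) (μ : Measure Circle)
    (hue : UniquelyErgodicWith f μ) (hna : ∀ z : Circle, μ {z} = 0)
    (m : ℕ) (hm : 2 ≤ m) :
    ∃ A : Circle → Matrix (Fin m) (Fin m) ℝ, ContGL A ∧ ¬ IsUniformCocycle f A := by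
  obtain ⟨k, rfl⟩ := Nat.exists_eq_add_of_le hm
  have hfc := hf.continuous
  have hfw := hasWinding_one_of_forall_ne hfc (hue.apply_ne hfc.measurable hna)
  obtain ⟨v, hv, hnot⟩ := exists_not_tendsto_log_norm_prodCoeff f
    (w := fun y : Circle => (y : ℂ)) Circle.norm_coe 1
  set u : Circle → ℂ := fun y => starRingEnd ℂ v * y
  have hu : ∀ x, ‖u x‖ = 1 := fun x => by
    simp only [u, norm_mul, RCLike.norm_conj, hv, Circle.norm_coe, one_mul]
  have huc : Continuous u := by fun_prop
  have huw : HasWinding u 1 := by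
    have hv0 : starRingEnd ℂ v ≠ 0 := by
      rw [← norm_pos_iff, RCLike.norm_conj, hv]
      exact one_pos
    exact zero_add (1 : ℤ) ▸ (HasWinding.const hv0).mul HasWinding.coe
  refine ⟨hyperbolicMatrix k u, contGL_hyperbolicMatrix k huc hu, fun ⟨L, hL⟩ => hnot ?_⟩
  exact tendsto_log_norm_prodCoeff_zero hfc hue hfw huc hu huw
    (tendstoUniformly_log_norm_prodCoeff k hu hL) 1
end
end

section
/- Let (X,f) be a dynamical system which is an extension of an irrational rotation (𝕋¹, R_α) on the circle (i.e., there is an irrational α ∈ (0,1) and a continuous surjection π : X → 𝕋¹ with π ∘ f = R_α ∘ π, where R_α(z) = e^{2πiα} z). Then for every m ≥ 2 there exists a non-uniform A ∈ C(X, GL(m,ℝ)). -/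
open MeasureTheory Filter Topology Set
open scoped ENNReal NNReal

attribute [local instance] Matrix.normedAddCommGroup

noncomputable section

open scoped ComplexConjugate in
/-- The pair `(a, b)` such that `v ↦ a * v + b * conj v` is the composition of the real-linear maps
`v ↦ (5 / 4) * w * v + (3 / 4) * conj (w * v)` for `w = z, ρ * z, …, ρ ^ (n - 1) * z`. -/
def hermanPair (ρ : ℂ) : ℕ → ℂ → ℂ × ℂ
  | 0, _ => (1, 0)
  | n + 1, z =>
    (z * (5 / 4 * (hermanPair ρ n (ρ * z)).1 + 3 / 4 * (hermanPair ρ n (ρ * z)).2),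
      conj z * (3 / 4 * (hermanPair ρ n (ρ * z)).1 + 5 / 4 * (hermanPair ρ n (ρ * z)).2))

section HermanPair

open scoped ComplexConjugate

variable {ρ : ℂ}

lemma Complex.mul_conj_eq_one {z : ℂ} (hz : ‖z‖ = 1) : z * conj z = 1 := by
  rw [Complex.mul_conj', hz]; simp

lemma hermanPair_det (hρ : ‖ρ‖ = 1) (n : ℕ) {z : ℂ} (hz : ‖z‖ = 1) :
    (hermanPair ρ n z).1 * conj (hermanPair ρ n z).1
      - (hermanPair ρ n z).2 * conj (hermanPair ρ n z).2 = 1 := by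
  induction n generalizing z with
  | zero => simp [hermanPair]
  | succ n ih =>
    have h1 := ih (z := ρ * z) (by simp [hρ, hz])
    have h2 := Complex.mul_conj_eq_one hz
    simp only [hermanPair, map_mul, map_add, map_div₀, Complex.conj_conj, map_ofNat]
    linear_combination h1 + h2 * ((hermanPair ρ n (ρ * z)).1 * conj (hermanPair ρ n (ρ * z)).1
      - (hermanPair ρ n (ρ * z)).2 * conj (hermanPair ρ n (ρ * z)).2)

lemma norm_hermanPair_sq (hρ : ‖ρ‖ = 1) (n : ℕ) {z : ℂ} (hz : ‖z‖ = 1) :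
    ‖(hermanPair ρ n z).1‖ ^ 2 = ‖(hermanPair ρ n z).2‖ ^ 2 + 1 := by
  have h := hermanPair_det hρ n hz
  rw [Complex.mul_conj', Complex.mul_conj'] at h
  have h' : ‖(hermanPair ρ n z).1‖ ^ 2 - ‖(hermanPair ρ n z).2‖ ^ 2 = 1 := by exact_mod_cast h
  linarith

lemma one_le_norm_hermanPair_fst (hρ : ‖ρ‖ = 1) (n : ℕ) {z : ℂ} (hz : ‖z‖ = 1) :
    1 ≤ ‖(hermanPair ρ n z).1‖ := by
  have := norm_hermanPair_sq hρ n hz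
  nlinarith [norm_nonneg (hermanPair ρ n z).1, sq_nonneg ‖(hermanPair ρ n z).2‖]

lemma norm_hermanPair_snd_le (hρ : ‖ρ‖ = 1) (n : ℕ) {z : ℂ} (hz : ‖z‖ = 1) :
    ‖(hermanPair ρ n z).2‖ ≤ ‖(hermanPair ρ n z).1‖ := by
  have := norm_hermanPair_sq hρ n hz
  exact le_of_sq_le_sq (by linarith) (norm_nonneg _)

lemma norm_hermanPair_succ_fst_le (hρ : ‖ρ‖ = 1) (n : ℕ) {z : ℂ} (hz : ‖z‖ = 1) :
    ‖(hermanPair ρ (n + 1) z).1‖ ≤ 2 * ‖(hermanPair ρ n (ρ * z)).1‖ := by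
  have h := norm_hermanPair_snd_le hρ n (z := ρ * z) (by simp [hρ, hz])
  simp only [hermanPair, norm_mul, hz, one_mul]
  refine (norm_add_le _ _).trans ?_
  simp only [norm_mul, norm_div, RCLike.norm_ofNat]
  linarith

lemma le_norm_hermanPair_succ_fst (hρ : ‖ρ‖ = 1) (n : ℕ) {z : ℂ} (hz : ‖z‖ = 1) :
    ‖(hermanPair ρ n (ρ * z)).1‖ / 2 ≤ ‖(hermanPair ρ (n + 1) z).1‖ := by
  have h := norm_hermanPair_snd_le hρ n (z := ρ * z) (by simp [hρ, hz])
  simp only [hermanPair, norm_mul, hz, one_mul]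
  refine le_trans ?_ (norm_sub_le_norm_add _ _)
  simp only [norm_mul, norm_div, RCLike.norm_ofNat]
  linarith

lemma hermanPair_succ_eq (n : ℕ) (z : ℂ) :
    (hermanPair ρ (n + 1) z).1 = 5 / 4 * (ρ ^ n * z) * (hermanPair ρ n z).1
        + 3 / 4 * conj (ρ ^ n * z) * conj (hermanPair ρ n z).2 ∧
      (hermanPair ρ (n + 1) z).2 = 5 / 4 * (ρ ^ n * z) * (hermanPair ρ n z).2
        + 3 / 4 * conj (ρ ^ n * z) * conj (hermanPair ρ n z).1 := by
  induction n generalizing z with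
  | zero => simp [hermanPair, mul_comm]
  | succ n ih =>
    obtain ⟨h1, h2⟩ := ih (ρ * z)
    rw [hermanPair]
    simp only [h1, h2]
    simp only [hermanPair, map_mul, map_add, map_div₀, Complex.conj_conj, map_ofNat, pow_succ]
    constructor <;> ring

lemma norm_hermanPair_wronskian (hρ : ‖ρ‖ = 1) (n : ℕ) {z : ℂ} (hz : ‖z‖ = 1) :
    ‖(hermanPair ρ (n + 1) z).2 * (hermanPair ρ n z).1
      - (hermanPair ρ (n + 1) z).1 * (hermanPair ρ n z).2‖ = 3 / 4 := by
  obtain ⟨h1, h2⟩ := hermanPair_succ_eq (ρ := ρ) n z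
  have h3 : (hermanPair ρ (n + 1) z).2 * (hermanPair ρ n z).1
      - (hermanPair ρ (n + 1) z).1 * (hermanPair ρ n z).2 = 3 / 4 * conj (ρ ^ n * z) := by
    rw [h1, h2]
    linear_combination (3 / 4 * conj (ρ ^ n * z)) * hermanPair_det hρ n hz
  rw [h3]
  simp [hρ, hz]

lemma continuous_hermanPair (n : ℕ) : Continuous (hermanPair ρ n) := by
  induction n with
  | zero => exact continuous_const
  | succ n ih =>
    have : Continuous fun z => hermanPair ρ n (ρ * z) := by fun_prop
    have hc := Complex.continuous_conj
    simp only [funext (fun z => hermanPair.eq_2 ρ z n)]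
    fun_prop

lemma exists_differentiable_hermanPair (hρ : ‖ρ‖ = 1) (n : ℕ) :
    ∃ (κ : ℂ) (p q : ℂ → ℂ), ‖κ‖ = 1 ∧ Differentiable ℂ p ∧ Differentiable ℂ q ∧
      p 0 = (5 / 4) ^ n ∧ q 0 = 0 ∧ ∀ z, ‖z‖ = 1 →
        hermanPair ρ n z = (κ * z ^ n * p (conj z), κ * z ^ n * q (conj z)) := by
  induction n with
  | zero => exact ⟨1, fun _ => 1, fun _ => 0, by simp, by fun_prop, by fun_prop, by simp, rfl,
      by simp [hermanPair]⟩
  | succ n ih =>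
    obtain ⟨κ, p, q, hκ, hp, hq, hp0, hq0, h⟩ := ih
    refine ⟨κ * ρ ^ n, fun u => 5 / 4 * p (conj ρ * u) + 3 / 4 * q (conj ρ * u),
      fun u => u ^ 2 * (3 / 4 * p (conj ρ * u) + 5 / 4 * q (conj ρ * u)), by simp [hκ, hρ],
      by fun_prop, by fun_prop, by simp [hp0, hq0, pow_succ, mul_comm], by simp, ?_⟩
    intro z hz
    have h2 := Complex.mul_conj_eq_one hz
    simp only [hermanPair, h (ρ * z) (by simp [hρ, hz]), map_mul]
    ext
    · ring
    · simp only
      linear_combination (-κ * ρ ^ n * z ^ n * conj z * (3 / 4 * p (conj ρ * conj z)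
        + 5 / 4 * q (conj ρ * conj z))) * h2

lemma exists_pow_le_norm_hermanPair (hρ : ‖ρ‖ = 1) (n : ℕ) :
    ∃ z : ℂ, ‖z‖ = 1 ∧ (5 / 4) ^ n ≤ ‖(hermanPair ρ n z).1‖ := by
  obtain ⟨κ, p, q, hκ, hp, -, hp0, -, h⟩ := exists_differentiable_hermanPair hρ n
  obtain ⟨u, hu, hmax⟩ := Complex.exists_mem_frontier_isMaxOn_norm
    (Metric.isBounded_ball (x := (0 : ℂ)) (r := 1)) ⟨0, by simp⟩ hp.diffContOnCl
  rw [frontier_ball _ one_ne_zero, mem_sphere_zero_iff_norm] at hu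
  refine ⟨conj u, by simpa using hu, ?_⟩
  have h0 := hmax (subset_closure (Metric.mem_ball_self one_pos))
  rw [h _ (by simpa using hu)]
  simpa [hκ, hu, hp0] using h0

end HermanPair

lemma exists_continuous_exp_eq {A : Type*} [TopologicalSpace A] [SimplyConnectedSpace A]
    [LocallyPathConnectedSpace A] {W : A → ℂ} (hW : Continuous W) (hW0 : ∀ t, W t ≠ 0) :
    ∃ θ : A → ℂ, Continuous θ ∧ ∀ t, Complex.exp (θ t) = W t := by
  obtain ⟨a⟩ : Nonempty A := inferInstance
  obtain ⟨F, ⟨-, hF⟩, -⟩ := Complex.isCoveringMapOn_exp.existsUnique_continuousMap_lifts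
    ⟨W, hW⟩ (a₀ := a) (Complex.exp_log (hW0 a)) hW0
  exact ⟨F, F.continuous, congrFun hF⟩

lemma exists_eq_const_of_exp_eq_one {h : ℝ → ℂ} (hc : Continuous h)
    (h1 : ∀ t, Complex.exp (h t) = 1) : ∃ c, ∀ t, h t = c :=
  ⟨h 0, fun t => Complex.isCoveringMap_exp.const_of_comp hc
    (fun t t' => Subtype.ext ((h1 t).trans (h1 t').symm)) t 0⟩

/-- A continuous function on the circle satisfies no cohomological equation with a twist of
nonzero degree. -/
lemma not_exp_mul_eq_comp_add {W g : ℝ → ℂ} (hW : Continuous W) (hW0 : ∀ t, W t ≠ 0)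
    (hWp : Function.Periodic W (2 * Real.pi)) (hg : Continuous g)
    (hgp : Function.Periodic g (2 * Real.pi)) (β : ℝ)
    (h : ∀ t : ℝ, Complex.exp (2 * t * Complex.I) * W t * Complex.exp (g t) = W (t + β)) :
    False := by
  obtain ⟨θ, hθ, hθW⟩ := exists_continuous_exp_eq hW hW0
  obtain ⟨c, hc⟩ := exists_eq_const_of_exp_eq_one
    (h := fun t => 2 * t * Complex.I + θ t + g t - θ (t + β)) (by fun_prop) (fun t => by
      rw [Complex.exp_sub, Complex.exp_add, Complex.exp_add, hθW, hθW, h, div_self (hW0 _)])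
  obtain ⟨d, hd⟩ := exists_eq_const_of_exp_eq_one
    (h := fun t => θ (t + 2 * Real.pi) - θ t) (by fun_prop) (fun t => by
      rw [Complex.exp_sub, hθW, hθW, hWp, div_self (hW0 _)])
  have h1 := hc 0
  have h2 := hc (0 + 2 * Real.pi)
  have h3 := hd 0
  have h4 := hd (0 + β)
  have h5 := hgp 0
  simp only [add_right_comm (0 : ℝ) _ β] at h2
  have h6 : (4 * Real.pi * Complex.I : ℂ) = 0 := by
    push_cast at h1 h2 
    linear_combination h2 - h1 - h3 + h4 - h5
  simp [Real.pi_ne_zero] at h6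

/-- Along a circle rotation, the cocycle stays bounded at some point at every time. -/
lemma exists_norm_hermanPair_le (β : ℝ) (n : ℕ) :
    ∃ t : ℝ, ‖(hermanPair (Circle.exp β) n (Circle.exp t)).1‖ ≤ 2 := by
  by_contra! hK
  set ρ : ℂ := (Circle.exp β : ℂ) with hρdef
  have hρ : ‖ρ‖ = 1 := Circle.norm_coe _
  let z : ℝ → ℂ := fun t => Circle.exp t
  have hz : ∀ t, ‖z t‖ = 1 := fun t => Circle.norm_coe _
  have hzc : Continuous z := by fun_prop
  have hzp : Function.Periodic z (2 * Real.pi) := fun t =>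
    congrArg Subtype.val (Circle.periodic_exp t)
  have hzβ : ∀ t, ρ * z t = z (t + β) := fun t => by
    simp only [z, hρdef, Circle.exp_add, Circle.coe_mul, mul_comm]
  let a : ℝ → ℂ := fun t => (hermanPair ρ n (z t)).1
  let b : ℝ → ℂ := fun t => (hermanPair ρ n (z t)).2
  let a' : ℝ → ℂ := fun t => (hermanPair ρ (n + 1) (z t)).1
  let b' : ℝ → ℂ := fun t => (hermanPair ρ (n + 1) (z t)).2
  have hac : Continuous a := ((continuous_hermanPair n).comp hzc).fst
  have hbc : Continuous b := ((continuous_hermanPair n).comp hzc).snd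
  have ha'c : Continuous a' := ((continuous_hermanPair (n + 1)).comp hzc).fst
  have hb'c : Continuous b' := ((continuous_hermanPair (n + 1)).comp hzc).snd
  have hap : Function.Periodic a (2 * Real.pi) := fun t => by simp only [a, hzp t]
  have hbp : Function.Periodic b (2 * Real.pi) := fun t => by simp only [b, hzp t]
  have ha'p : Function.Periodic a' (2 * Real.pi) := fun t => by simp only [a', hzp t]
  have hb'p : Function.Periodic b' (2 * Real.pi) := fun t => by simp only [b', hzp t]
  have ha2 : ∀ t, 2 < ‖a t‖ := hK
  have hab : ∀ t, ‖a t‖ ^ 2 = ‖b t‖ ^ 2 + 1 := fun t => norm_hermanPair_sq hρ n (hz t)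
  have hba : ∀ t, ‖b t‖ ≤ ‖a t‖ := fun t => norm_hermanPair_snd_le hρ n (hz t)
  have hb0 : ∀ t, 3 / 5 * ‖a t‖ < ‖b t‖ := fun t => by
    nlinarith [hab t, ha2 t, norm_nonneg (b t)]
  have ha'1 : ∀ t, 1 < ‖a' t‖ := fun t => by
    have h1 := le_norm_hermanPair_succ_fst hρ n (hz t)
    have h2 := ha2 (t + β)
    simp only [hzβ, a, a'] at *
    linarith
  have hane : ∀ t, a t ≠ 0 := fun t => norm_pos_iff.1 (by linarith [ha2 t])
  have hbne : ∀ t, b t ≠ 0 := fun t => norm_pos_iff.1 (by linarith [ha2 t, hb0 t])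
  have ha'ne : ∀ t, a' t ≠ 0 := fun t => norm_pos_iff.1 (by linarith [ha'1 t])
  let r : ℝ → ℂ := fun t => 1 + (b' t * a t - a' t * b t) / (a' t * b t)
  let q : ℝ → ℂ := fun t => 1 + 3 / 5 * (b (t + β) / a (t + β))
  let p : ℝ → ℂ := fun t => 1 + 3 / 5 * (a (t + β) / b (t + β))
  have slit : ∀ w : ℂ, ‖w‖ < 1 → 1 + w ∈ Complex.slitPlane := fun w hw =>
    Complex.mem_slitPlane_of_norm_lt_one hw
  have hr : ∀ t, r t ∈ Complex.slitPlane := fun t => by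
    refine slit _ ?_
    rw [norm_div, norm_hermanPair_wronskian hρ n (hz t), norm_mul, div_lt_one]
    · nlinarith [hb0 t, ha2 t, ha'1 t]
    · nlinarith [hb0 t, ha2 t, ha'1 t]
  have hq : ∀ t, q t ∈ Complex.slitPlane := fun t => by
    refine slit _ ?_
    have := hba (t + β)
    have := ha2 (t + β)
    rw [norm_mul, norm_div, norm_div, RCLike.norm_ofNat, RCLike.norm_ofNat, ← mul_div_assoc,
      div_lt_one] <;> linarith
  have hp : ∀ t, p t ∈ Complex.slitPlane := fun t => by
    refine slit _ ?_
    have := hb0 (t + β)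
    have := ha2 (t + β)
    rw [norm_mul, norm_div, norm_div, RCLike.norm_ofNat, RCLike.norm_ofNat, ← mul_div_assoc,
      div_lt_one] <;> linarith
  have hrc : Continuous r := by
    refine continuous_const.add (Continuous.div (by fun_prop) (by fun_prop) fun t => ?_)
    exact mul_ne_zero (ha'ne t) (hbne t)
  have hqc : Continuous q := continuous_const.add (continuous_const.mul
    (Continuous.div (by fun_prop) (by fun_prop) fun t => hane _))
  have hpc : Continuous p := continuous_const.add (continuous_const.mul
    (Continuous.div (by fun_prop) (by fun_prop) fun t => hbne _))
  have hper : ∀ t, t + 2 * Real.pi + β = t + β + 2 * Real.pi := fun t => by ring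
  refine not_exp_mul_eq_comp_add (W := fun t => b t / a t)
    (g := fun t => Complex.log (r t) + Complex.log (q t) - Complex.log (p t)) (β := β)
    (hbc.div hac hane) (fun t => div_ne_zero (hbne t) (hane t))
    (fun t => by simp only [hap t, hbp t])
    (((hrc.clog hr).add (hqc.clog hq)).sub (hpc.clog hp))
    (fun t => by simp only [r, q, p, hper, hap _, hbp _, ha'p _, hb'p _]) fun t => ?_
  have hpne := Complex.slitPlane_ne_zero (hp t)
  rw [Complex.exp_sub, Complex.exp_add, Complex.exp_log (Complex.slitPlane_ne_zero (hr t)),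
    Complex.exp_log (Complex.slitPlane_ne_zero (hq t)), Complex.exp_log hpne]
  have hexp : Complex.exp (2 * t * Complex.I) = z t * z t := by
    simp only [z, Circle.coe_exp, ← Complex.exp_add]
    ring_nf
  have hr' : r t = b' t * a t / (a' t * b t) := by
    have := ha'ne t; have := hbne t
    simp only [r]; field_simp; ring
  have hq' : q t * (5 / 4 * a (t + β)) = 5 / 4 * a (t + β) + 3 / 4 * b (t + β) := by
    have := hane (t + β)
    simp only [q]; field_simp
  have hp' : p t * (5 / 4 * b (t + β)) = 3 / 4 * a (t + β) + 5 / 4 * b (t + β) := by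
    have := hbne (t + β)
    simp only [p]; field_simp; ring
  have ha' : a' t = z t * (q t * (5 / 4 * a (t + β))) := by
    rw [hq']; simp only [a', hermanPair, a, b, hzβ]
  have hb' : b' t * z t = p t * (5 / 4 * b (t + β)) := by
    rw [hp']; simp only [b', hermanPair, a, b, hzβ]
    linear_combination (3 / 4 * (hermanPair ρ n (z (t + β))).1
      + 5 / 4 * (hermanPair ρ n (z (t + β))).2) * Complex.mul_conj_eq_one (hz t)
  have h1 := hane t; have h2 := hbne t; have h3 := ha'ne t; have h4 := hane (t + β)
  have h5 := Complex.slitPlane_ne_zero (hq t)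
  have h6 : z t ≠ 0 := norm_pos_iff.1 (by simp [hz t])
  calc Complex.exp (2 * t * Complex.I) * (b t / a t) * (r t * q t / p t)
      = z t * (b' t * z t) * q t / (a' t * p t) := by rw [hexp, hr']; field_simp
    _ = b (t + β) / a (t + β) := by rw [hb', ha']; field_simp

lemma TendstoUniformly.of_abs_sub_le {ι : Type*} {F G : ℕ → ι → ℝ} {L : ι → ℝ}
    (h : TendstoUniformly F L atTop) {u : ℕ → ℝ} (hu : Tendsto u atTop (𝓝 0))
    (hFG : ∀ n x, |F n x - G n x| ≤ u n) : TendstoUniformly G L atTop := by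
  rw [Metric.tendstoUniformly_iff] at h ⊢
  intro ε hε
  filter_upwards [h (ε / 2) (half_pos hε), hu.eventually (gt_mem_nhds (half_pos hε))] with n h1 h2 x
  have := h1 x
  rw [Real.dist_eq] at this ⊢
  have := abs_sub_le (L x) (F n x) (G n x)
  linarith [hFG n x]

lemma abs_log_sub_log_le_log_two {x y : ℝ} (hx : 0 < x) (hy : 0 < y) (hxy : x ≤ 2 * y)
    (hyx : y ≤ 2 * x) : |Real.log x - Real.log y| ≤ Real.log 2 := by
  have h1 := Real.log_le_log hx hxy
  have h2 := Real.log_le_log hy hyx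
  rw [Real.log_mul two_ne_zero hy.ne'] at h1
  rw [Real.log_mul two_ne_zero hx.ne'] at h2
  rw [abs_le]
  constructor <;> linarith

lemma Continuous.eq_of_periodic_of_irrational {E : Type*} [TopologicalSpace E] [T2Space E]
    {ℓ : ℝ → E} (hℓ : Continuous ℓ) {a b : ℝ} (ha : Function.Periodic ℓ a)
    (hb : Function.Periodic ℓ b) (hab : Irrational (a / b)) (t : ℝ) : ℓ t = ℓ 0 := by
  have h : ∀ c ∈ AddSubgroup.closure {a, b}, Function.Periodic ℓ c := fun c hc => by
    induction hc using AddSubgroup.closure_induction with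
    | mem x hx => rcases hx with rfl | rfl <;> assumption
    | zero => simp [Function.Periodic]
    | add x y _ _ hx hy => exact hx.add_period hy
    | neg x _ hx => exact hx.neg
  refine congrFun (Continuous.ext_on (dense_addSubgroupClosure_pair_iff.2 hab) hℓ
    (continuous_const (y := ℓ 0)) fun c hc => ?_) t
  simpa using h c hc 0

lemma not_tendstoUniformly_log_norm_hermanPair {α : ℝ} (hα : Irrational α) (ℓ : ℝ → ℝ) :
    ¬ TendstoUniformly (fun (n : ℕ) (t : ℝ) =>
      Real.log ‖(hermanPair (Circle.exp (2 * Real.pi * α)) n (Circle.exp t)).1‖ / n) ℓ atTop := by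
  intro hlim
  set β := 2 * Real.pi * α with hβ
  set ρ : ℂ := (Circle.exp β : ℂ) with hρdef
  have hρ : ‖ρ‖ = 1 := Circle.norm_coe _
  have hz : ∀ t, ‖(Circle.exp t : ℂ)‖ = 1 := fun t => Circle.norm_coe _
  have hone : ∀ n t, 1 ≤ ‖(hermanPair ρ n (Circle.exp t)).1‖ := fun n t =>
    one_le_norm_hermanPair_fst hρ n (hz t)
  have hcont : Continuous ℓ := hlim.continuous <| .of_forall fun n => by
    have := (continuous_hermanPair (ρ := ρ) n).comp (f := fun t : ℝ => (Circle.exp t : ℂ))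
      (by fun_prop)
    exact (this.fst.norm.log fun t => (zero_lt_one.trans_le (hone n t)).ne').div_const _
  have hlt := hlim.tendsto_at
  have hper : Function.Periodic ℓ (2 * Real.pi) := fun t => by
    have h := hlt (t + 2 * Real.pi)
    rw [Circle.periodic_exp t] at h
    exact tendsto_nhds_unique h (hlt t)
  have hperβ : Function.Periodic ℓ β := fun t => by
    have h1 : Tendsto (fun n : ℕ =>
        Real.log ‖(hermanPair ρ (n + 1) (Circle.exp t)).1‖ / n) atTop (𝓝 (ℓ t)) := by
      have h := ((tendsto_add_atTop_iff_nat 1).2 (hlt t)).mul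
        (tendsto_const_nhds.add tendsto_one_div_atTop_nhds_zero_nat : Tendsto
          (fun n : ℕ => (1 : ℝ) + 1 / n) atTop (𝓝 (1 + 0)))
      rw [add_zero, mul_one] at h
      refine h.congr' ?_
      filter_upwards [eventually_gt_atTop 0] with n hn
      have : (n : ℝ) ≠ 0 := by positivity
      push_cast
      field_simp
    have h2 : Tendsto (fun n : ℕ => Real.log 2 / n) atTop (𝓝 0) :=
      tendsto_const_div_atTop_nhds_zero_nat _
    refine tendsto_nhds_unique (hlt (t + β)) ?_
    have h3 := h1.sub (squeeze_zero_norm (a := fun n : ℕ => Real.log 2 / n) (f := fun n : ℕ =>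
      Real.log ‖(hermanPair ρ (n + 1) (Circle.exp t)).1‖ / n -
      Real.log ‖(hermanPair ρ n (Circle.exp (t + β))).1‖ / n) (fun n => ?_) h2)
    · simpa using h3
    · have h4 := norm_hermanPair_succ_fst_le hρ n (hz t)
      have h5 := le_norm_hermanPair_succ_fst hρ n (hz t)
      have h6 : ρ * Circle.exp t = Circle.exp (t + β) := by
        simp only [hρdef, Circle.exp_add, Circle.coe_mul, mul_comm]
      rw [h6] at h4 h5
      rw [← sub_div, norm_div, Real.norm_natCast, Real.norm_eq_abs]
      gcongr
      exact abs_log_sub_log_le_log_two (zero_lt_one.trans_le (hone _ _))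
        (zero_lt_one.trans_le (hone _ _)) h4 (by linarith)
  have hconst := hcont.eq_of_periodic_of_irrational hperβ hper
    (by rwa [hβ, mul_div_cancel_left₀ _ (by positivity)])
  have hle : Real.log (5 / 4) ≤ ℓ 0 := by
    refine le_of_forall_pos_le_add fun ε hε => ?_
    obtain ⟨n, h1, hn⟩ :=
      ((Metric.tendstoUniformly_iff.1 hlim ε hε).and (eventually_gt_atTop 0)).exists
    obtain ⟨z, hz1, hz2⟩ := exists_pow_le_norm_hermanPair hρ n
    obtain ⟨t, ht⟩ := Circle.exp_surjective ⟨z, mem_sphere_zero_iff_norm.2 hz1⟩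
    have h2 := h1 t
    rw [Real.dist_eq, hconst, ht] at h2
    have h3 : Real.log (5 / 4) ≤ Real.log ‖(hermanPair ρ n z).1‖ / n := by
      rw [le_div_iff₀ (by positivity), mul_comm, ← Real.log_pow]
      exact Real.log_le_log (by positivity) hz2
    have h4 := (abs_lt.1 h2).1
    simp only at h4
    linarith
  have hge : ℓ 0 ≤ 0 := by
    choose t ht using exists_norm_hermanPair_le β
    have h1 : Tendsto (fun n : ℕ => Real.log 2 / n) atTop (𝓝 0) :=
      tendsto_const_div_atTop_nhds_zero_nat _
    refine le_of_forall_pos_le_add fun ε hε => ?_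
    obtain ⟨n, h2, hn⟩ := ((Metric.tendstoUniformly_iff.1 hlim (ε / 2) (half_pos hε)).and
      (h1.eventually (gt_mem_nhds (half_pos hε)))).exists
    have h3 := h2 (t n)
    rw [Real.dist_eq, hconst] at h3
    have h4 : Real.log ‖(hermanPair ρ n (Circle.exp (t n))).1‖ / n ≤ Real.log 2 / n := by
      gcongr
      · exact zero_lt_one.trans_le (hone _ _)
      · exact ht n
    linarith [(abs_lt.1 h3).2]
  have : 0 < Real.log (5 / 4) := Real.log_pos (by norm_num)
  linarith

section BlockMatrix

open scoped ComplexConjugate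

/-- The matrix of the real-linear map `v ↦ a * v + b * conj v` on `ℂ ≃ ℝ²`, extended by the identity
to dimension `2 + k`. -/
def blockMatrix (k : ℕ) (p : ℂ × ℂ) : Matrix (Fin (2 + k)) (Fin (2 + k)) ℝ :=
  Matrix.reindex finSumFinEquiv finSumFinEquiv (Matrix.fromBlocks
    !![p.1.re + p.2.re, p.2.im - p.1.im; p.1.im + p.2.im, p.1.re - p.2.re] 0 0 1)

variable (k : ℕ)

lemma blockMatrix_one : blockMatrix k (1, 0) = 1 := by
  have : (!![1, 0; 0, 1] : Matrix (Fin 2) (Fin 2) ℝ) = 1 := Matrix.one_fin_two.symm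
  simp [blockMatrix, this, Matrix.fromBlocks_one]

lemma blockMatrix_mul (p q : ℂ × ℂ) : blockMatrix k p * blockMatrix k q =
    blockMatrix k (p.1 * q.1 + p.2 * conj q.2, p.1 * q.2 + p.2 * conj q.1) := by
  simp only [blockMatrix, Matrix.reindex_apply, Matrix.submatrix_mul_equiv,
    Matrix.fromBlocks_multiply]
  congr 2
  · ext i j
    fin_cases i <;> fin_cases j <;> simp <;> ring
  all_goals simp

lemma det_blockMatrix (p : ℂ × ℂ) : (blockMatrix k p).det = ‖p.1‖ ^ 2 - ‖p.2‖ ^ 2 := by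
  rw [blockMatrix, Matrix.det_reindex_self, Matrix.det_fromBlocks_zero₂₁, Matrix.det_one,
    Matrix.det_fin_two, Complex.sq_norm, Complex.sq_norm, Complex.normSq_apply,
    Complex.normSq_apply]
  simp
  ring

lemma continuous_blockMatrix : Continuous (blockMatrix k) := by
  refine (Continuous.matrix_fromBlocks ?_ continuous_const continuous_const
    continuous_const).matrix_reindex _ _
  refine continuous_matrix fun i j => ?_
  fin_cases i <;> fin_cases j <;> simp <;> fun_prop

lemma norm_blockMatrix_le {p : ℂ × ℂ} (h1 : 1 ≤ ‖p.1‖) (h2 : ‖p.2‖ ≤ ‖p.1‖) :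
    ‖blockMatrix k p‖ ≤ 2 * ‖p.1‖ := by
  rw [Matrix.norm_le_iff (by positivity)]
  intro i j
  have := Complex.abs_re_le_norm p.1
  have := Complex.abs_re_le_norm p.2
  have := Complex.abs_im_le_norm p.1
  have := Complex.abs_im_le_norm p.2
  simp only [blockMatrix, Matrix.reindex_apply, Matrix.submatrix_apply]
  generalize finSumFinEquiv.symm i = i
  generalize finSumFinEquiv.symm j = j
  rcases i with i | i <;> rcases j with j | j
  · fin_cases i <;> fin_cases j <;> simp <;> grind
  · simp
  · simp
  · rw [Matrix.fromBlocks_apply₂₂, Matrix.one_apply]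
    split_ifs <;> simp
    all_goals linarith

lemma norm_fst_le_norm_blockMatrix (p : ℂ × ℂ) : ‖p.1‖ ≤ 2 * ‖blockMatrix k p‖ := by
  have h : ∀ i j : Fin 2, |(!![p.1.re + p.2.re, p.2.im - p.1.im;
      p.1.im + p.2.im, p.1.re - p.2.re] : Matrix (Fin 2) (Fin 2) ℝ) i j| ≤ ‖blockMatrix k p‖ :=
    fun i j => by
      simpa [blockMatrix] using Matrix.norm_entry_le_entrywise_sup_norm (blockMatrix k p)
        (i := finSumFinEquiv (.inl i)) (j := finSumFinEquiv (.inl j))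
  have h00 := h 0 0
  have h01 := h 0 1
  have h10 := h 1 0
  have h11 := h 1 1
  simp at h00 h01 h10 h11
  have := Complex.norm_le_abs_re_add_abs_im p.1
  grind

end BlockMatrix

lemma cocycle_blockMatrix {X : Type*} {f : X → X} {π : X → Circle} {ρ : Circle}
    (hcomm : ∀ x : X, π (f x) = ρ * π x) (k n : ℕ) (x : X) :
    cocycle f (fun x => blockMatrix k (hermanPair ρ 1 (π x))) n x =
      blockMatrix k (hermanPair ρ n (π x)) := by
  have hiter : ∀ n, π (f^[n] x) = ρ ^ n * π x := fun n => by
    induction n with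
    | zero => simp
    | succ n ih => rw [Function.iterate_succ_apply', hcomm, ih, pow_succ', mul_assoc]
  induction n with
  | zero => exact (blockMatrix_one k).symm
  | succ n ih =>
    rw [cocycle, ih, blockMatrix_mul, hiter]
    congr 1
    obtain ⟨h1, h2⟩ := hermanPair_succ_eq (ρ := ρ) n (π x)
    ext1
    · rw [h1]; simp [hermanPair]; ring
    · rw [h2]; simp [hermanPair]; ring

/-- Proposition 3.2: a dynamical system which extends an irrational rotation of the circle
admits a non-uniform continuous `GL(m,ℝ)`-cocycle for every `m ≥ 2`. -/
theorem exists_nonuniform_cocycle_of_extension_of_irrational_rotation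
    {X : Type*} [MetricSpace X] [CompactSpace X]
    (f : X → X) (hf : IsHomeomorph f)
    (α : ℝ) (hα0 : 0 < α) (hα1 : α < 1) (hirr : Irrational α)
    (π : X → Circle) (hπc : Continuous π) (hπs : Function.Surjective π)
    (hcomm : ∀ x : X, π (f x) = Circle.exp (2 * Real.pi * α) * π x)
    (m : ℕ) (hm : 2 ≤ m) :
    ∃ A : X → Matrix (Fin m) (Fin m) ℝ, ContGL A ∧ ¬ IsUniformCocycle f A := by
  obtain ⟨k, rfl⟩ := Nat.exists_eq_add_of_le hm
  set ρ := Circle.exp (2 * Real.pi * α) with hρdef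
  have hρ : ‖(ρ : ℂ)‖ = 1 := Circle.norm_coe _
  refine ⟨fun x => blockMatrix k (hermanPair ρ 1 (π x)), ⟨?_, fun x => ?_⟩, ?_⟩
  · exact (continuous_blockMatrix k).comp
      ((continuous_hermanPair 1).comp (continuous_subtype_val.comp hπc))
  · rw [Matrix.isUnit_iff_isUnit_det, det_blockMatrix,
      norm_hermanPair_sq hρ 1 (Circle.norm_coe (π x))]
    simp
  · rintro ⟨L, hL⟩
    choose σ hσ using hπs
    refine not_tendstoUniformly_log_norm_hermanPair hirr (fun t => L (σ (Circle.exp t)))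
      ((hL.comp fun t => σ (Circle.exp t)).of_abs_sub_le
        (tendsto_const_div_atTop_nhds_zero_nat (Real.log 2)) fun n t => ?_)
    have h1 := one_le_norm_hermanPair_fst hρ n (Circle.norm_coe (Circle.exp t))
    have h2 := norm_blockMatrix_le k h1
      (norm_hermanPair_snd_le hρ n (Circle.norm_coe (Circle.exp t)))
    have h3 := norm_fst_le_norm_blockMatrix k (hermanPair ρ n (Circle.exp t))
    simp only [Function.comp_apply, cocycle_blockMatrix hcomm, hσ]
    rw [← sub_div, abs_div, Nat.abs_cast]
    gcongr
    exact abs_log_sub_log_le_log_two (by linarith) (by linarith) h2 h3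
end
end

section
/- Let (X,f) be a dynamical system with finitely many but at least two f-ergodic Borel probability measures. Then for every f-ergodic Borel probability measure ν there exists a continuous function φ : X → ℝ such that ∫φ dν > ∫φ dμ for every f-invariant Borel probability measure μ with μ ≠ ν. -/
open MeasureTheory Filter Topology Set
open scoped ENNReal NNReal

attribute [local instance] Matrix.normedAddCommGroup

noncomputable section

namespace Ergodic

variable {X : Type*} [MeasurableSpace X] {f : X → X} {μ ν : Measure X}

/-- Two distinct ergodic probability measures are mutually singular. -/
theorem mutuallySingular_of_ne [IsProbabilityMeasure μ] [IsProbabilityMeasure ν]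
    (hμ : Ergodic f μ) (hν : Ergodic f ν) (hne : μ ≠ ν) : μ ⟂ₘ ν := by
  obtain ⟨c, hc⟩ := hν.eq_smul_of_absolutelyContinuous
    (hμ.toMeasurePreserving.withDensity_rnDeriv hν.toMeasurePreserving)
    (withDensity_absolutelyContinuous ν (μ.rnDeriv ν))
  have hdec : μ = μ.singularPart ν + c • ν := by
    rw [← hc]; exact μ.haveLebesgueDecomposition_add ν
  rcases eq_or_ne c 0 with rfl | hc₀
  · rw [zero_smul, add_zero] at hdec
    rw [hdec]
    exact Measure.mutuallySingular_singularPart μ ν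
  · refine absurd ?_ hne
    refine (hμ.eq_of_absolutelyContinuous hν.toMeasurePreserving ?_).symm
    have h : c • ν ≪ μ := by
      refine Measure.absolutelyContinuous_of_le ?_
      conv_rhs => rw [hdec]
      exact Measure.le_add_left le_rfl
    exact (Measure.absolutelyContinuous_smul hc₀).trans h

end Ergodic

/-- A probability measure that is singular with respect to each of finitely many finite measures
is separated from them by the integral of a continuous function. -/
theorem exists_continuous_integral_lt_of_mutuallySingular {X : Type*} [MetricSpace X]
    [CompactSpace X] [MeasurableSpace X] [BorelSpace X] (ν : Measure X) [IsProbabilityMeasure ν]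
    {S : Set (Measure X)} (hS : S.Finite) (hfin : ∀ μ ∈ S, IsFiniteMeasure μ)
    (hsing : ∀ μ ∈ S, ν ⟂ₘ μ) :
    ∃ φ : C(X, ℝ), ∀ μ ∈ S, ∫ x, φ x ∂μ < ∫ x, φ x ∂ν := by
  choose! A hAm hAν hAμ using hsing
  set B : Set X := ⋂ μ ∈ S, (A μ)ᶜ with hB
  have hBm : MeasurableSet B := hS.measurableSet_biInter fun μ hμ => (hAm μ hμ).compl
  have hBc : ν Bᶜ = 0 := by
    rw [hB, compl_iInter₂, measure_biUnion_null_iff hS.countable]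
    simpa using hAν
  have hBν : ν B = 1 := (prob_compl_eq_zero_iff hBm).1 hBc
  obtain ⟨K, hKB, hK, hKν⟩ := hBm.exists_lt_isCompact (μ := ν) (r := 1 / 2)
    (by rw [hBν]; exact ENNReal.half_lt_self one_ne_zero ENNReal.one_ne_top)
  have hU : ∀ μ ∈ S, ∃ U ⊇ K, IsOpen U ∧ μ U < 1 / 2 := by
    intro μ hμ
    have := hfin μ hμ
    refine K.exists_isOpen_lt_of_lt (μ := μ) _ ?_
    rw [measure_mono_null (hKB.trans (iInter₂_subset μ hμ)) (hAμ μ hμ)]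
    simp
  choose! U hKU hUo hUμ using hU
  obtain ⟨φ, hφ0, hφ1, hφ⟩ := exists_continuous_zero_one_of_isClosed
    (hS.isOpen_biInter hUo).isClosed_compl hK.isClosed
    (disjoint_compl_left_iff_subset.2 (subset_iInter₂ hKU))
  have hint : ∀ μ : Measure X, IsFiniteMeasure μ → Integrable φ μ := fun μ _ =>
    φ.continuous.integrable_of_hasCompactSupport (HasCompactSupport.of_compactSpace _)
  refine ⟨φ, fun μ hμ => ?_⟩
  have := hfin μ hμ
  have hup : ∫ x, φ x ∂μ ≤ μ.real (U μ) := by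
    rw [← integral_indicator_one (hUo μ hμ).measurableSet]
    refine integral_mono (hint μ this)
      ((integrable_const (1 : ℝ)).indicator (hUo μ hμ).measurableSet) fun x => ?_
    by_cases hx : x ∈ U μ
    · simpa [hx] using (hφ x).2
    · have : x ∈ (⋂ μ ∈ S, U μ)ᶜ := fun h => hx (mem_iInter₂.1 h μ hμ)
      simp [hx, hφ0 this]
  have hlow : ν.real K ≤ ∫ x, φ x ∂ν := by
    rw [← integral_indicator_one hK.measurableSet]
    refine integral_mono ((integrable_const (1 : ℝ)).indicator hK.measurableSet)
      (hint ν inferInstance) fun x => ?_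
    by_cases hx : x ∈ K
    · simp [hx, hφ1 hx]
    · simpa [hx] using (hφ x).1
  have h₁ : μ.real (U μ) < 1 / 2 := by
    have := (ENNReal.toReal_lt_toReal (measure_ne_top μ _) (by simp)).2 (hUμ μ hμ)
    simpa [Measure.real] using this
  have h₂ : 1 / 2 < ν.real K := by
    have := (ENNReal.toReal_lt_toReal (by simp) (measure_ne_top ν _)).2 hKν
    simpa [Measure.real] using this
  linarith

section Integration

variable {X : Type*} [MetricSpace X] [MeasurableSpace X] [BorelSpace X]

/-- A measure, seen as the family of its integrals of continuous functions. -/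
def integralFamily (μ : Measure X) : C(X, ℝ) → ℝ := fun g => ∫ x, g x ∂μ

theorem integralFamily_inj {μ ν : Measure X} [IsFiniteMeasure μ] [IsFiniteMeasure ν] :
    integralFamily μ = integralFamily ν ↔ μ = ν := by
  refine ⟨fun h => ?_, fun h => by rw [h]⟩
  exact ext_of_forall_integral_eq_of_IsFiniteMeasure fun g => congrFun h g.toContinuousMap

theorem measurePreserving_iff_integral_continuousMap {f : X → X} (hf : Continuous f)
    (μ : Measure X) [IsFiniteMeasure μ] :
    MeasurePreserving f μ μ ↔ ∀ g : C(X, ℝ), ∫ x, g (f x) ∂μ = ∫ x, g x ∂μ := by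
  have hmap : ∀ g : C(X, ℝ), ∫ x, g x ∂(μ.map f) = ∫ x, g (f x) ∂μ := fun g =>
    integral_map hf.aemeasurable g.continuous.aestronglyMeasurable
  refine ⟨fun h g => by rw [← hmap, h.map_eq], fun h => ⟨hf.measurable, ?_⟩⟩
  rw [← integralFamily_inj]
  ext g
  exact (hmap g).trans (h g)

variable [CompactSpace X]

theorem integrable_continuousMap (g : C(X, ℝ)) (μ : Measure X) [IsFiniteMeasure μ] :
    Integrable g μ :=
  g.continuous.integrable_of_hasCompactSupport (HasCompactSupport.of_compactSpace _)

theorem continuous_integral_continuousMap_s18 (g : C(X, ℝ)) :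
    Continuous fun μ : ProbabilityMeasure X => ∫ x, g x ∂(μ : Measure X) :=
  ProbabilityMeasure.continuous_integral_boundedContinuousFunction
    (BoundedContinuousFunction.mkOfCompact g)

theorem integralFamily_add_smul {μ ν : Measure X} [IsFiniteMeasure μ] [IsFiniteMeasure ν]
    {a b : ℝ≥0∞} (ha : a ≠ ∞) (hb : b ≠ ∞) :
    integralFamily (a • μ + b • ν) =
      a.toReal • integralFamily μ + b.toReal • integralFamily ν := by
  ext g
  have h := integral_add_measure ((integrable_continuousMap g μ).smul_measure ha)
    ((integrable_continuousMap g ν).smul_measure hb)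
  simpa [integralFamily] using h

theorem isCompact_integralFamily_image_invariant {f : X → X} (hf : Continuous f) :
    IsCompact (integralFamily '' {μ | MeasurePreserving f μ μ ∧ IsProbabilityMeasure μ}) := by
  have hclosed : IsClosed {μ : ProbabilityMeasure X |
      ∀ g : C(X, ℝ), ∫ x, g (f x) ∂(μ : Measure X) = ∫ x, g x ∂(μ : Measure X)} := by
    simp only [ofPred_forall]
    exact isClosed_iInter fun g => isClosed_eq
      (continuous_integral_continuousMap_s18 (g.comp ⟨f, hf⟩)) (continuous_integral_continuousMap_s18 g)
  have hcont : Continuous fun μ : ProbabilityMeasure X => integralFamily (μ : Measure X) :=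
    continuous_pi continuous_integral_continuousMap_s18
  convert! hclosed.isCompact.image hcont using 1
  ext y
  constructor
  · rintro ⟨μ, ⟨hμ, hp⟩, rfl⟩
    exact ⟨⟨μ, hp⟩, (measurePreserving_iff_integral_continuousMap hf μ).1 hμ, rfl⟩
  · rintro ⟨μ, hμ, rfl⟩
    exact ⟨μ, ⟨(measurePreserving_iff_integral_continuousMap hf _).2 hμ, inferInstance⟩, rfl⟩

theorem convex_integralFamily_image_invariant (f : X → X) :
    Convex ℝ (integralFamily '' {μ | MeasurePreserving f μ μ ∧ IsProbabilityMeasure μ}) := by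
  rintro _ ⟨μ, ⟨hμ, hμp⟩, rfl⟩ _ ⟨ν, ⟨hν, hνp⟩, rfl⟩ a b ha hb hab
  refine ⟨ENNReal.ofReal a • μ + ENNReal.ofReal b • ν, ⟨?_, ⟨?_⟩⟩, ?_⟩
  · exact (hμ.smul_measure _).add_measure (hν.smul_measure _)
  · simp [← ENNReal.ofReal_add ha hb, hab]
  · rw [integralFamily_add_smul ENNReal.ofReal_ne_top ENNReal.ofReal_ne_top,
      ENNReal.toReal_ofReal ha, ENNReal.toReal_ofReal hb]

theorem extremePoints_integralFamily_image_invariant_subset (f : X → X) :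
    (integralFamily '' {μ | MeasurePreserving f μ μ ∧ IsProbabilityMeasure μ}).extremePoints ℝ ⊆
      integralFamily '' {μ | IsProbabilityMeasure μ ∧ Ergodic f μ} := by
  rintro _ ⟨⟨μ, ⟨hμ, hp⟩, rfl⟩, hext⟩
  refine ⟨μ, ⟨hp, Ergodic.of_mem_extremePoints ?_⟩, rfl⟩
  rw [mem_extremePoints_iff_left]
  refine ⟨⟨hμ, hp⟩, ?_⟩
  rintro μ₁ ⟨h₁, hp₁⟩ μ₂ ⟨h₂, hp₂⟩ ⟨a, b, ha, hb, hab, rfl⟩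
  have ha' : a ≠ ∞ := by rintro rfl; simp at hab
  have hb' : b ≠ ∞ := by rintro rfl; simp at hab
  rw [← integralFamily_inj]
  refine hext ⟨μ₁, ⟨h₁, hp₁⟩, rfl⟩ ⟨μ₂, ⟨h₂, hp₂⟩, rfl⟩
    ⟨a.toReal, b.toReal, ENNReal.toReal_pos ha.ne' ha', ENNReal.toReal_pos hb.ne' hb', ?_,
      (integralFamily_add_smul ha' hb').symm⟩
  rw [← ENNReal.toReal_add ha' hb', hab, ENNReal.toReal_one]

/-- If there are finitely many ergodic measures, every invariant probability measure is a convex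
combination of them. -/
theorem integralFamily_mem_convexHull_ergodic {f : X → X} (hf : Continuous f)
    (hfin : {μ : Measure X | IsProbabilityMeasure μ ∧ Ergodic f μ}.Finite)
    {μ : Measure X} [IsProbabilityMeasure μ] (hμ : MeasurePreserving f μ μ) :
    integralFamily μ ∈
      convexHull ℝ (integralFamily '' {μ | IsProbabilityMeasure μ ∧ Ergodic f μ}) := by
  have h := closure_convexHull_extremePoints (isCompact_integralFamily_image_invariant hf)
    (convex_integralFamily_image_invariant f)
  rw [← ((hfin.image _).isCompact_convexHull (𝕜 := ℝ)).isClosed.closure_eq]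
  refine closure_mono (convexHull_mono (extremePoints_integralFamily_image_invariant_subset f)) ?_
  rw [h]
  exact ⟨μ, ⟨hμ, inferInstance⟩, rfl⟩

end Integration

/-- Adding one boundary point to an open half-space keeps it convex. -/
theorem convex_insert_halfSpace_lt {E : Type*} [AddCommGroup E] [Module ℝ E] (l : E →ₗ[ℝ] ℝ)
    (v : E) : Convex ℝ (insert v {x | l x < l v}) := by
  intro x hx y hy a b ha hb hab
  have hle : ∀ z ∈ insert v {x | l x < l v}, l z ≤ l v := by
    rintro z (rfl | hz)
    exacts [le_rfl, le_of_lt hz]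
  obtain rfl | ha := ha.eq_or_lt
  · obtain rfl : b = 1 := by linarith
    simpa using hy
  obtain rfl | hb := hb.eq_or_lt
  · obtain rfl : a = 1 := by linarith
    simpa using hx
  have hv : l v = a * l v + b * l v := by rw [← add_mul, hab, one_mul]
  rcases hx with rfl | hx'
  · rcases hy with rfl | hy'
    · left; rw [← add_smul, hab, one_smul]
    · right
      simp only [mem_ofPred_eq, map_add, map_smul, smul_eq_mul] at hy' ⊢
      nlinarith
  · right
    have := hle y hy
    simp only [mem_ofPred_eq, map_add, map_smul, smul_eq_mul] at hx' ⊢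
    nlinarith

/-- Lemma 4.1: if `(X,f)` has finitely many but at least two ergodic Borel probability
measures, then for each ergodic measure `ν` there is a continuous `φ : X → ℝ` whose
integral against `ν` is strictly larger than its integral against any other invariant
probability measure. -/
theorem exists_continuous_separating_ergodic
    {X : Type*} [MetricSpace X] [CompactSpace X] [MeasurableSpace X] [BorelSpace X]
    (f : X → X) (hf : IsHomeomorph f)
    (hfin : {μ : Measure X | IsProbabilityMeasure μ ∧ Ergodic f μ}.Finite)
    (hcard : 2 ≤ {μ : Measure X | IsProbabilityMeasure μ ∧ Ergodic f μ}.ncard)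
    (ν : Measure X) (hν : IsProbabilityMeasure ν ∧ Ergodic f ν) :
    ∃ φ : X → ℝ, Continuous φ ∧
      ∀ μ : Measure X, InvProb f μ → μ ≠ ν → ∫ x, φ x ∂μ < ∫ x, φ x ∂ν := by
  obtain ⟨hνp, hνe⟩ := hν
  obtain ⟨φ, hφ⟩ := exists_continuous_integral_lt_of_mutuallySingular ν
    (hfin.subset (sdiff_subset (t := {ν}))) (fun μ hμ => by have := hμ.1.1; infer_instance)
    (fun μ hμ => by
      have := hμ.1.1
      exact hνe.mutuallySingular_of_ne hμ.1.2 (Ne.symm hμ.2))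
  refine ⟨φ, φ.continuous, fun μ ⟨hμp, hμ⟩ hne => ?_⟩
  have hmem := integralFamily_mem_convexHull_ergodic hf.continuous hfin
    ⟨hf.continuous.measurable, hμ⟩
  have hsub := convexHull_min (s := integralFamily '' {μ | IsProbabilityMeasure μ ∧ Ergodic f μ})
    (by
      rintro _ ⟨ρ, hρ, rfl⟩
      rcases eq_or_ne ρ ν with rfl | hρν
      · exact mem_insert _ _
      · exact mem_insert_of_mem _ (hφ ρ ⟨hρ, hρν⟩))
    (convex_insert_halfSpace_lt (LinearMap.proj φ) (integralFamily ν))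
  rcases hsub hmem with h | h
  · exact absurd (integralFamily_inj.1 h) hne
  · exact h
end
end
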